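/- arXiv:1302.5394 — 3 statements merged into one kernel-verified Lean document; each statement's English description precedes it below -/
import Mathlib

section
/- Let r ≥ 2 be an integer and let F be a hypergraph on vertex set [n] = {1,...,n}. Then the chromatic number of the Kneser hypergraph KG^r(F) satisfies χ(KG^r(F)) ≥ (n − alt_r(F)) / (r − 1). -/
open Finset

/-- A proper `t`-coloring of the Kneser hypergraph `KG^r(F)`: vertices are the members of `F`,
colors are taken in `{1,...,t}`, and no set of `r` pairwise disjoint members of `F`
(an edge) is monochromatic. -/
def IsKneserColoring (n r t : ℕ) (F : Finset (Finset (Fin n)))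
    (c : Finset (Fin n) → ℕ) : Prop :=
  (∀ A ∈ F, c A ∈ Finset.Icc 1 t) ∧
    ∀ E : Finset (Finset (Fin n)), E ⊆ F → E.card = r →
      ((E : Set (Finset (Fin n))).Pairwise fun A B => Disjoint A B) →
      ¬ ∃ i, ∀ A ∈ E, c A = i

/-- The chromatic number of the Kneser hypergraph `KG^r(F)`. -/
noncomputable def kneserChrom (n r : ℕ) (F : Finset (Finset (Fin n))) : ℕ :=
  sInf {t | ∃ c, IsKneserColoring n r t F c}

/-- `l` is (the index list of) an alternating subsequence of
`(X (σ 1), ..., X (σ n))`: indices are increasing, all chosen entries are nonzero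
(`≠ none`), and any two consecutive chosen entries differ. -/
def IsAltList {α : Type*} (n : ℕ) (σ : Equiv.Perm (Fin n))
    (X : Fin n → Option α) (l : List (Fin n)) : Prop :=
  l.Chain' (· < ·) ∧ (∀ i ∈ l, X (σ i) ≠ none) ∧
    l.Chain' (fun i j => X (σ i) ≠ X (σ j))

/-- `alt_σ(X)`: maximum length of an alternating subsequence of nonzero entries of
`(X (σ 1), ..., X (σ n))`. -/
noncomputable def altVec {α : Type*} (n : ℕ) (σ : Equiv.Perm (Fin n))
    (X : Fin n → Option α) : ℕ :=
  sSup {k | ∃ l : List (Fin n), IsAltList n σ X l ∧ l.length = k}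

/-- `alt_{r,σ}(F)`: the largest `ℓ` such that some nonzero `X ∈ (Z_r ∪ {0})^n` has
`alt_σ(X) = ℓ` and no `X^j` contains a member of `F`. -/
noncomputable def altHyp (n r : ℕ) (σ : Equiv.Perm (Fin n))
    (F : Finset (Finset (Fin n))) : ℕ :=
  sSup {k | ∃ X : Fin n → Option (Fin r), (∃ a, X a ≠ none) ∧
    altVec n σ X = k ∧ ∀ j : Fin r, ∀ A ∈ F, ¬ ∀ a ∈ A, X a = some j}

/-- `alt_r(F) = min_σ alt_{r,σ}(F)`. -/
noncomputable def altNum (n r : ℕ) (F : Finset (Finset (Fin n))) : ℕ :=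
  sInf {k | ∃ σ : Equiv.Perm (Fin n), altHyp n r σ F = k}

namespace KH
set_option linter.unusedSectionVars false

section alg
variable {r : ℕ} [NeZero r]

/-- generic differential: norm in odd degrees, `1 - t` in even degrees -/
def dd {M : Type*} [AddCommGroup M] [Module (ZMod r) M] (a : ZMod r → M →ₗ[ZMod r] M) (k : ℕ) :
    M →ₗ[ZMod r] M :=
  if Odd k then ∑ x, a x else LinearMap.id - a 1

theorem dd_odd {M : Type*} [AddCommGroup M] [Module (ZMod r) M] (a : ZMod r → M →ₗ[ZMod r] M)
    {k : ℕ} (hk : Odd k) (z : M) : dd a k z = ∑ x, a x z := by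
  simp [dd, hk]

theorem dd_even {M : Type*} [AddCommGroup M] [Module (ZMod r) M] (a : ZMod r → M →ₗ[ZMod r] M)
    {k : ℕ} (hk : Even k) (z : M) : dd a k z = z - a 1 z := by
  have : ¬ Odd k := by simpa using hk
  simp [dd, this]

theorem dd_dd {M : Type*} [AddCommGroup M] [Module (ZMod r) M] (a : ZMod r → M →ₗ[ZMod r] M)
    (ha : ∀ x y z, a x (a y z) = a (x + y) z) (k : ℕ) (z : M) :
    dd a (k + 1) (dd a k z) = 0 := by
  rcases Nat.even_or_odd k with hk | hk
  · rw [dd_odd a hk.add_one, dd_even a hk]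
    simp only [map_sub, Finset.sum_sub_distrib, ha]
    rw [sub_eq_zero]
    exact (Fintype.sum_equiv (Equiv.addRight (1 : ZMod r)) _ _ (fun x => rfl)).symm
  · rw [dd_even a hk.add_one, dd_odd a hk]
    simp only [map_sum, ha]
    rw [sub_eq_zero]
    exact (Fintype.sum_equiv (Equiv.addLeft (1 : ZMod r)) _ _ (fun x => rfl)).symm

theorem dd_comm {M M' : Type*} [AddCommGroup M] [Module (ZMod r) M]
    [AddCommGroup M'] [Module (ZMod r) M'] (a : ZMod r → M →ₗ[ZMod r] M)
    (b : ZMod r → M' →ₗ[ZMod r] M') (f : M →ₗ[ZMod r] M')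
    (h : ∀ x z, f (a x z) = b x (f z)) (k : ℕ) (z : M) :
    f (dd a k z) = dd b k (f z) := by
  rcases Nat.even_or_odd k with hk | hk
  · simp [dd_even _ hk, h]
  · simp [dd_odd _ hk, h]

/-- regular representation -/
def act (x : ZMod r) : (ZMod r → ZMod r) →ₗ[ZMod r] (ZMod r → ZMod r) :=
  LinearMap.funLeft _ _ (fun j => j - x)

@[simp] theorem act_apply (x : ZMod r) (f : ZMod r → ZMod r) (j : ZMod r) :
    act x f j = f (j - x) := rfl

theorem act_act (x y : ZMod r) (f : ZMod r → ZMod r) : act x (act y f) = act (x + y) f := by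
  ext j; simp [sub_sub]

theorem act_zero (f : ZMod r → ZMod r) : act 0 f = f := by
  ext j; simp

def etaO : (ZMod r → ZMod r) →ₗ[ZMod r] (ZMod r → ZMod r) where
  toFun f := fun j => if j = 0 then f (-1) else 0
  map_add' f g := by ext j; by_cases h : j = 0 <;> simp [h]
  map_smul' c f := by ext j; by_cases h : j = 0 <;> simp [h]

def etaE : (ZMod r → ZMod r) →ₗ[ZMod r] (ZMod r → ZMod r) where
  toFun f := fun i => - ∑ j with i.val < j.val, f j
  map_add' f g := by ext j; simp [Finset.sum_add_distrib]; ring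
  map_smul' c f := by ext j; simp [Finset.mul_sum]

def eta (k : ℕ) : (ZMod r → ZMod r) →ₗ[ZMod r] (ZMod r → ZMod r) :=
  if Odd k then etaO else etaE

theorem val_neg_one : (-1 : ZMod r).val = r - 1 := by
  obtain ⟨m, rfl⟩ := Nat.exists_eq_succ_of_ne_zero (NeZero.ne r)
  exact ZMod.val_neg_one m

theorem val_sub_one (i : ZMod r) (hi : i ≠ 0) : (i - 1).val + 1 = i.val := by
  have h1 : 0 < i.val := by
    rw [Nat.pos_iff_ne_zero]; simpa using hi
  have h2 : ((i.val - 1 : ℕ) : ZMod r) = i - 1 := by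
    rw [Nat.cast_sub h1]; simp
  rw [← h2, ZMod.val_natCast_of_lt]
  · omega
  · have := ZMod.val_lt i; omega

theorem eq_sub_one (i j : ZMod r) (h : i.val + 1 = j.val) : i = j - 1 := by
  have h2 : ((i.val + 1 : ℕ) : ZMod r) = ((j.val : ℕ) : ZMod r) := by rw [h]
  push_cast at h2
  simp at h2
  rw [← h2]; ring

theorem filter_val_eq (i : ZMod r) (hi : i ≠ 0) :
    (univ.filter fun j : ZMod r => (i - 1).val < j.val) =
      insert i (univ.filter fun j : ZMod r => i.val < j.val) := by
  have := val_sub_one i hi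
  ext j
  simp only [mem_filter, mem_univ, true_and, mem_insert]
  constructor
  · intro h
    by_cases hj : j.val = i.val
    · left; exact ZMod.val_injective _ hj
    · right; omega
  · rintro (rfl | h) <;> omega

theorem tele (f : ZMod r → ZMod r) : ∀ (m : ℕ) (i : ZMod r), r - 1 - i.val = m →
    ∑ j with i.val < j.val, (f j - f (j - 1)) = f (-1) - f i := by
  intro m
  induction m with
  | zero =>
    intro i hi
    have hv := ZMod.val_lt i
    have : i = -1 := by
      apply ZMod.val_injective; rw [val_neg_one]; omega
    subst this
    rw [Finset.sum_eq_zero]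
    · simp
    · intro j hj
      simp only [mem_filter, mem_univ, true_and, val_neg_one] at hj
      have := ZMod.val_lt j
      omega
  | succ m ih =>
    intro i hi
    have hv := ZMod.val_lt i
    have hne : i + 1 ≠ 0 := by
      intro h0
      have : i = -1 := by rw [← sub_eq_zero]; simpa using h0
      rw [this, val_neg_one] at hi
      omega
    have h1 := val_sub_one (i + 1) hne
    have h2 := filter_val_eq (i + 1) hne
    rw [add_sub_cancel_right] at h1 h2
    rw [h2, Finset.sum_insert (by simp), ih (i + 1) (by omega)]
    simp

theorem sum_act (f : ZMod r → ZMod r) (j : ZMod r) : ∑ x, act x f j = ∑ x, f x := by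
  simp only [act_apply]
  exact (Equiv.subLeft j).sum_comp f

theorem contr (k : ℕ) (f : ZMod r → ZMod r) :
    dd act (k + 1) (eta (k + 1) f) + eta k (dd act k f) = f := by
  rcases Nat.even_or_odd k with hk | hk
  · have hk' : ¬ Odd k := by simpa using hk
    rw [dd_odd _ hk.add_one, dd_even _ hk]
    simp only [eta, hk.add_one, hk', if_true, if_false]
    ext i
    simp only [Pi.add_apply, Finset.sum_apply, sum_act]
    simp only [etaO, etaE, LinearMap.coe_mk, AddHom.coe_mk, Pi.sub_apply, act_apply]
    rw [tele f _ i rfl]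
    simp
  · have hk' : ¬ Odd (k + 1) := by simpa using hk.add_one
    rw [dd_even _ hk.add_one, dd_odd _ hk]
    simp only [eta, hk, hk', if_true, if_false]
    ext i
    simp only [etaO, etaE, LinearMap.coe_mk, AddHom.coe_mk, Pi.add_apply, Pi.sub_apply,
      act_apply, Finset.sum_apply]
    by_cases hi : i = 0
    · subst hi
      have h3 : ∑ x, f (-1 - x) = ∑ x, f x := (Equiv.subLeft (-1 : ZMod r)).sum_comp f
      have h0 : (univ.filter fun j : ZMod r => (0 - 1 : ZMod r).val < j.val) = ∅ := by
        ext j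
        have := ZMod.val_lt j
        simp only [zero_sub, val_neg_one, mem_filter, mem_univ, true_and, notMem_empty, iff_false]
        omega
      have h1 : (univ : Finset (ZMod r)) =
          insert 0 (univ.filter fun j : ZMod r => (0 : ZMod r).val < j.val) := by
        ext j
        by_cases hj : j = 0
        · simp [hj]
        · have : 0 < j.val := by
            rw [Nat.pos_iff_ne_zero]; simpa using hj
          simp [em]
      have h2 : ∑ x, f x = f 0 + ∑ j with (0 : ZMod r).val < j.val, f j := by
        conv_lhs => rw [h1]
        rw [Finset.sum_insert (by simp)]
      rw [h0, h3, h2]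
      simp
    · rw [filter_val_eq i hi, Finset.sum_insert (by simp)]
      simp [hi]

theorem eta_eta (k : ℕ) (f : ZMod r → ZMod r) : eta (k + 1) (eta k f) = 0 := by
  rcases Nat.even_or_odd k with hk | hk
  · have hk' : ¬ Odd k := by simpa using hk
    simp only [eta, hk.add_one, hk', if_true, if_false]
    ext i
    simp only [etaO, etaE, LinearMap.coe_mk, AddHom.coe_mk, Pi.zero_apply]
    split_ifs
    · rw [Finset.sum_eq_zero]
      · simp
      · intro j hj
        simp only [mem_filter, mem_univ, true_and, val_neg_one] at hj
        have := ZMod.val_lt j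
        omega
    · rfl
  · have hk' : ¬ Odd (k + 1) := by simpa using hk.add_one
    simp only [eta, hk, hk', if_true, if_false]
    ext i
    simp only [etaO, etaE, LinearMap.coe_mk, AddHom.coe_mk, Pi.zero_apply]
    rw [Finset.sum_eq_zero]
    · simp
    · intro j hj
      simp only [mem_filter, mem_univ, true_and] at hj
      rw [if_neg]
      rintro rfl
      simp at hj

/-- twisted contraction -/
def etaS (k : ℕ) (x : ZMod r) : (ZMod r → ZMod r) →ₗ[ZMod r] (ZMod r → ZMod r) :=
  act x ∘ₗ eta k ∘ₗ act (-x)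

theorem act_dd (x : ZMod r) (k : ℕ) (f : ZMod r → ZMod r) :
    act x (dd act k f) = dd act k (act x f) :=
  dd_comm act act (act x) (fun y z => by rw [act_act, act_act, add_comm]) k f

theorem contrS (k : ℕ) (x : ZMod r) (f : ZMod r → ZMod r) :
    dd act (k + 1) (etaS (k + 1) x f) + etaS k x (dd act k f) = f := by
  simp only [etaS, LinearMap.comp_apply]
  rw [← act_dd, act_dd (-x), ← map_add, contr, act_act]
  simp [act_zero]

theorem etaS_etaS (k : ℕ) (x : ZMod r) (f : ZMod r → ZMod r) :
    etaS (k + 1) x (etaS k x f) = 0 := by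
  simp only [etaS, LinearMap.comp_apply]
  rw [act_act (-x) x, neg_add_cancel, act_zero, eta_eta, map_zero]

theorem etaS_act (k : ℕ) (x y : ZMod r) (f : ZMod r → ZMod r) :
    etaS k (y + x) (act y f) = act y (etaS k x f) := by
  simp only [etaS, LinearMap.comp_apply]
  rw [act_act, act_act]
  congr 3
  ring_nf

/-- augmentation is determined on kernels of `dd` -/
theorem aug_zero (k : ℕ) (f : ZMod r → ZMod r) (h : dd act k f = 0) : ∑ x, f x = 0 := by
  rcases Nat.even_or_odd k with hk | hk
  · rw [dd_even _ hk] at h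
    have h1 : ∀ j, f j = f (j - 1) := fun j => by
      have := congrFun h j
      simpa [sub_eq_zero] using this
    have h2 : ∀ m : ℕ, f m = f 0 := by
      intro m
      induction m with
      | zero => simp
      | succ m ih => rw [h1]; simpa using ih
    have h3 : ∀ j, f j = f 0 := fun j => by
      have := h2 j.val
      simpa using this
    rw [Finset.sum_congr rfl (fun j _ => h3 j)]
    simp
  · rw [dd_odd _ hk] at h
    have := congrFun h 0
    rw [Finset.sum_apply, sum_act] at this
    exact this

end alg

section chains
variable {r : ℕ} [NeZero r] {ι : Type*}

abbrev Ch (r : ℕ) (ι : Type*) := List (ι × ZMod r) →₀ ZMod r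

noncomputable def consC (v : ι × ZMod r) : Ch r ι →ₗ[ZMod r] Ch r ι :=
  Finsupp.lmapDomain _ _ (List.cons v)

theorem consC_single (v : ι × ZMod r) (l : List (ι × ZMod r)) (a : ZMod r) :
    consC v (Finsupp.single l a) = Finsupp.single (v :: l) a := by
  simp [consC]

noncomputable def bd : List (ι × ZMod r) → Ch r ι
  | [] => 0
  | v :: l => Finsupp.single l 1 - consC v (bd l)

noncomputable def bdC : Ch r ι →ₗ[ZMod r] Ch r ι := Finsupp.linearCombination _ bd

theorem bdC_single (l : List (ι × ZMod r)) : bdC (Finsupp.single l 1) = bd l := by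
  simp [bdC]

theorem bdC_cons (v : ι × ZMod r) (z : Ch r ι) : bdC (consC v z) = z - consC v (bdC z) := by
  have : bdC ∘ₗ consC v = LinearMap.id - consC v ∘ₗ bdC (r := r) := by
    apply Finsupp.lhom_ext'
    intro l
    apply LinearMap.ext_ring
    simp only [LinearMap.comp_apply, Finsupp.lsingle_apply, LinearMap.sub_apply, LinearMap.id_apply,
      consC_single, bdC_single]
    rfl
  exact congrArg (fun f => f z) this

theorem bdC_bd (l : List (ι × ZMod r)) : bdC (bd l) = 0 := by
  induction l with
  | nil => simp [bd]
  | cons v l ih => simp [bd, bdC_cons, bdC_single, ih]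

def actV (x : ZMod r) (v : ι × ZMod r) : ι × ZMod r := (v.1, x + v.2)

noncomputable def actC (x : ZMod r) : Ch r ι →ₗ[ZMod r] Ch r ι :=
  Finsupp.lmapDomain _ _ (List.map (actV x))

theorem actC_single (x : ZMod r) (l : List (ι × ZMod r)) (a : ZMod r) :
    actC x (Finsupp.single l a) = Finsupp.single (l.map (actV x)) a := by
  simp [actC]

theorem actC_actC (x y : ZMod r) (z : Ch r ι) : actC x (actC y z) = actC (x + y) z := by
  simp only [actC, Finsupp.lmapDomain_apply, ← Finsupp.mapDomain_comp]
  congr 1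
  ext1 l
  simp only [Function.comp, List.map_map]
  congr 1
  ext1 v
  simp [actV, add_assoc]

theorem actC_cons (x : ZMod r) (v : ι × ZMod r) (z : Ch r ι) :
    actC x (consC v z) = consC (actV x v) (actC x z) := by
  simp only [actC, consC, Finsupp.lmapDomain_apply, ← Finsupp.mapDomain_comp]
  rfl

theorem actC_bd (x : ZMod r) (l : List (ι × ZMod r)) : actC x (bd l) = bd (l.map (actV x)) := by
  induction l with
  | nil => simp [bd]
  | cons v l ih => simp [bd, actC_cons, actC_single, ih]

theorem bdC_actC (x : ZMod r) (z : Ch r ι) : bdC (actC x z) = actC x (bdC z) := by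
  have : bdC ∘ₗ actC x = actC x ∘ₗ bdC (r := r) (ι := ι) := by
    apply Finsupp.lhom_ext'
    intro l
    apply LinearMap.ext_ring
    simp only [LinearMap.comp_apply, Finsupp.lsingle_apply, actC_single, bdC_single, actC_bd]
  exact congrArg (fun f => f z) this

theorem bd_support (l l' : List (ι × ZMod r)) (h : l' ∈ (bd l).support) :
    l'.Sublist l ∧ l'.length + 1 = l.length := by
  classical
  induction l generalizing l' with
  | nil => simp [bd] at h
  | cons v l ih =>
    rw [bd] at h
    rcases Finset.mem_union.1 (Finsupp.support_sub h) with h | h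
    · have := Finsupp.support_single_subset h
      simp only [Finset.mem_singleton] at this
      subst this
      simp
    · rw [consC, Finsupp.lmapDomain_apply] at h
      obtain ⟨l'', h1, rfl⟩ := Finset.mem_image.1 (Finsupp.mapDomain_support h)
      obtain ⟨h2, h3⟩ := ih _ h1
      exact ⟨h2.cons_cons v, by simp [h3]⟩

noncomputable def Phi (s : List (ι × ZMod r) → ZMod r) : ℕ → Ch r ι →ₗ[ZMod r] (ZMod r → ZMod r)
  | 0 => Finsupp.linearCombination _ (fun _ => fun _ => 1)
  | k + 1 => Finsupp.linearCombination _ (fun l => etaS (k + 1) (s l) (Phi s k (bd l)))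

variable (s : List (ι × ZMod r) → ZMod r)

theorem Phi_single (k : ℕ) (l : List (ι × ZMod r)) :
    Phi s (k + 1) (Finsupp.single l 1) = etaS (k + 1) (s l) (Phi s k (bd l)) := by
  simp [Phi]

theorem act_Phi_zero (x : ZMod r) (z : Ch r ι) : act x (Phi s 0 z) = Phi s 0 z := by
  ext j
  simp [Phi, Finsupp.linearCombination_apply, Finsupp.sum]

theorem dd_Phi (k : ℕ) (z : Ch r ι) : dd act (k + 1) (Phi s (k + 1) z) = Phi s k (bdC z) := by
  induction k generalizing z with
  | zero =>
    have : dd act (0 + 1) ∘ₗ Phi s (0 + 1) = Phi s 0 ∘ₗ bdC := by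
      apply Finsupp.lhom_ext'
      intro l
      apply LinearMap.ext_ring
      simp only [LinearMap.comp_apply, Finsupp.lsingle_apply, Phi_single, bdC_single]
      have h := contrS 0 (s l) (Phi s 0 (bd l))
      rw [dd_even (act (r := r)) (k := 0) (by simp), act_Phi_zero, sub_self, map_zero, add_zero] at h
      exact h
    exact congrArg (fun f => f z) this
  | succ k ih =>
    have : dd act (k + 1 + 1) ∘ₗ Phi s (k + 1 + 1) = Phi s (k + 1) ∘ₗ bdC := by
      apply Finsupp.lhom_ext'
      intro l
      apply LinearMap.ext_ring
      simp only [LinearMap.comp_apply, Finsupp.lsingle_apply, Phi_single s (k + 1), bdC_single]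
      have h := contrS (k + 1) (s l) (Phi s (k + 1) (bd l))
      rw [ih, bdC_bd, map_zero, map_zero, add_zero] at h
      exact h
    exact congrArg (fun f => f z) this

theorem Phi_act (hs : ∀ x l, l ≠ [] → s (l.map (actV x)) = x + s l) (k : ℕ) (x : ZMod r)
    (z : Ch r ι) : Phi s k (actC x z) = act x (Phi s k z) := by
  induction k generalizing z with
  | zero =>
    rw [act_Phi_zero]
    have : Phi s 0 ∘ₗ actC x = Phi s 0 := by
      apply Finsupp.lhom_ext'
      intro l
      apply LinearMap.ext_ring
      simp [LinearMap.comp_apply, actC_single, Phi]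
    exact congrArg (fun f => f z) this
  | succ k ih =>
    have : Phi s (k + 1) ∘ₗ actC x = act x ∘ₗ Phi s (k + 1) := by
      apply Finsupp.lhom_ext'
      intro l
      apply LinearMap.ext_ring
      simp only [LinearMap.comp_apply, Finsupp.lsingle_apply, actC_single, Phi_single]
      by_cases hl : l = []
      · subst hl; simp [bd]
      · rw [hs x l hl, ← actC_bd, ih, etaS_act]
    exact congrArg (fun f => f z) this

/-- the universal chains -/
noncomputable def sig : List ι → Ch r ι
  | [] => Finsupp.single [] 1
  | a :: l => match l with
    | [] => Finsupp.single [(a, 0)] 1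
    | b :: l' => consC (a, 0) (dd actC (l'.length + 2) (sig (b :: l')))

theorem sig_cons (a b : ι) (l : List ι) : (sig (a :: b :: l) : Ch r ι) =
    consC (a, 0) (dd actC (l.length + 2) (sig (b :: l))) := rfl

theorem bdC_sig (a b : ι) (l : List ι) : bdC (sig (a :: b :: l) : Ch r ι) =
    dd actC (l.length + 2) (sig (b :: l)) := by
  induction l generalizing a b with
  | nil =>
    rw [sig_cons, bdC_cons, dd_comm (actC (r := r) (ι := ι)) actC bdC bdC_actC]
    have : bdC (sig [b] : Ch r ι) = Finsupp.single [] 1 := by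
      simp [sig, bdC_single, bd]
    have h0 : dd actC 2 (Finsupp.single [] 1 : Ch r ι) = 0 := by
      rw [dd_even (actC (r := r) (ι := ι)) (by simp)]
      simp [actC_single]
    rw [this]
    simp [h0]
  | cons c l ih =>
    rw [sig_cons, bdC_cons, dd_comm (actC (r := r) (ι := ι)) actC bdC bdC_actC, ih]
    simp only [List.length_cons]
    rw [show l.length + 1 + 2 = l.length + 2 + 1 from rfl, dd_dd (actC (r := r) (ι := ι)) actC_actC]
    simp

theorem aug_sig (hs : ∀ x l, l ≠ [] → s (l.map (actV x)) = x + s l) (a : ι) (l : List ι) :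
    ∑ x, Phi s (l.length + 1) (sig (a :: l)) x = 1 := by
  induction l generalizing a with
  | nil =>
    have h : (sig [a] : Ch r ι) = Finsupp.single [(a, 0)] 1 := rfl
    have h2 : bd [(a, (0 : ZMod r))] = Finsupp.single [] 1 := by simp [bd]
    rw [h]
    simp only [List.length_nil]
    rw [Phi_single, h2]
    have h3 : Phi s 0 (Finsupp.single [] 1) = fun _ => 1 := by simp [Phi]
    rw [h3]
    simp [etaS, eta, etaO]
    simp [sub_eq_zero, Finset.filter_eq']
  | cons b l ih =>
    have h1 := dd_Phi s (l.length + 1) (sig (a :: b :: l))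
    rw [bdC_sig, dd_comm actC act (Phi s _) (Phi_act s hs _)] at h1
    have h2 := aug_zero (l.length + 2)
      (Phi s (l.length + 2) (sig (a :: b :: l)) - Phi s (l.length + 1) (sig (b :: l)))
      (by rw [map_sub, sub_eq_zero]; exact h1)
    simp only [Pi.sub_apply, Finset.sum_sub_distrib] at h2
    rw [ih b, sub_eq_zero] at h2
    exact h2

theorem dd_actC_support (k : ℕ) (P : List (ι × ZMod r) → Prop)
    (hP : ∀ x l, P l → P (l.map (actV x))) (z : Ch r ι) (hz : ∀ l ∈ z.support, P l) :
    ∀ l ∈ (dd actC k z).support, P l := by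
  classical
  have h1 : ∀ x, ∀ l ∈ (actC x z).support, P l := by
    intro x l hl
    rw [actC, Finsupp.lmapDomain_apply] at hl
    obtain ⟨l', h1, rfl⟩ := Finset.mem_image.1 (Finsupp.mapDomain_support hl)
    exact hP _ _ (hz _ h1)
  intro l hl
  rcases Nat.even_or_odd k with hk | hk
  · rw [dd_even _ hk] at hl
    rcases Finset.mem_union.1 (Finsupp.support_sub hl) with h | h
    · exact hz _ h
    · exact h1 _ _ h
  · rw [dd_odd _ hk] at hl
    obtain ⟨x, _, hx⟩ := Finset.mem_biUnion.1 (Finsupp.support_finsetSum hl)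
    exact h1 x _ hx

theorem sig_support (l : List ι) : ∀ L ∈ (sig l : Ch r ι).support, L.map Prod.fst = l := by
  classical
  induction l with
  | nil =>
    intro L hL
    have := Finsupp.support_single_subset hL
    simp only [Finset.mem_singleton] at this
    simp [this]
  | cons a l ih =>
    cases l with
    | nil =>
      intro L hL
      have := Finsupp.support_single_subset hL
      simp only [Finset.mem_singleton] at this
      simp [this]
    | cons b l =>
      intro L hL
      rw [sig_cons, consC, Finsupp.lmapDomain_apply] at hL
      obtain ⟨L', h1, rfl⟩ := Finset.mem_image.1 (Finsupp.mapDomain_support hL)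
      have := dd_actC_support (l.length + 2) (fun L => L.map Prod.fst = b :: l)
        (fun x L h => by simpa [Function.comp_def, actV] using h) _ ih L' h1
      simp [this]

theorem exists_of_linear {M N : Type*} [AddCommGroup M] [Module (ZMod r) M]
    (f : (N →₀ ZMod r) →ₗ[ZMod r] M) (z : N →₀ ZMod r) (h : f z ≠ 0) :
    ∃ l ∈ z.support, f (Finsupp.single l 1) ≠ 0 := by
  by_contra hc
  push Not at hc
  apply h
  rw [← Finsupp.sum_single z, Finsupp.sum, map_sum]
  apply Finset.sum_eq_zero
  intro l hl
  have : Finsupp.single l (z l) = z l • Finsupp.single l (1 : ZMod r) := by simp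
  rw [this, map_smul, hc l hl, smul_zero]

theorem chain_bound (h : List (ι × ZMod r) → ℕ)
    (hpos : ∀ l, l ≠ [] → (l.map Prod.fst).Nodup → 1 ≤ h l)
    (hmono : ∀ l l', l ≠ [] → l.Sublist l' → (l'.map Prod.fst).Nodup → h l ≤ h l')
    (heq : ∀ l l', l ≠ [] → l.Sublist l' → (l'.map Prod.fst).Nodup → h l = h l' → s l = s l')
    (k : ℕ) (L : List (ι × ZMod r)) (hL : L.length = k + 1) (hnd : (L.map Prod.fst).Nodup)
    (hne : Phi s (k + 1) (Finsupp.single L 1) ≠ 0) : k + 1 ≤ h L := by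
  induction k generalizing L with
  | zero => exact hpos L (by rintro rfl; simp at hL) hnd
  | succ k ih =>
    rw [Phi_single] at hne
    obtain ⟨L', h1, h2⟩ := exists_of_linear (etaS (k + 1 + 1) (s L) ∘ₗ Phi s (k + 1)) (bd L) hne
    obtain ⟨h3, h4⟩ := bd_support _ _ h1
    rw [LinearMap.comp_apply] at h2
    have hL' : L' ≠ [] := by
      rintro rfl
      simp at h4; omega
    have h5 := ih L' (by omega) ((h3.map Prod.fst).nodup hnd)
      (by intro h0; rw [h0] at h2; simp at h2)
    have h6 := hmono L' L hL' h3 hnd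
    have h7 : h L' ≠ h L := by
      intro he
      have hss := heq L' L hL' h3 hnd he
      rw [Phi_single, hss, etaS_etaS] at h2
      exact h2 rfl
    omega

end chains

section tucker
variable {r : ℕ} {ι : Type*} [DecidableEq ι]

def vec : List (ι × ZMod r) → ι → Option (ZMod r)
  | [] => fun _ => none
  | v :: l => Function.update (vec l) v.1 (some v.2)

theorem vec_map (x : ZMod r) (l : List (ι × ZMod r)) :
    vec (l.map (actV x)) = fun i => (vec l i).map (x + ·) := by
  induction l with
  | nil => rfl
  | cons v l ih =>
    ext1 i
    simp only [List.map_cons, vec, ih]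
    by_cases h : i = v.1
    · subst h; simp [actV]
    · simp [actV, h]

theorem vec_notMem (l : List (ι × ZMod r)) (i : ι) (h : i ∉ l.map Prod.fst) : vec l i = none := by
  induction l with
  | nil => rfl
  | cons v l ih =>
    simp only [List.map_cons, List.mem_cons, not_or] at h
    simp [vec, h.1, ih h.2]

theorem vec_ne (l : List (ι × ZMod r)) (h : l ≠ []) : ∃ i, vec l i ≠ none := by
  cases l with
  | nil => simp at h
  | cons v l => exact ⟨v.1, by simp [vec]⟩

theorem vec_mono (l l' : List (ι × ZMod r)) (h : l.Sublist l') (hn : (l'.map Prod.fst).Nodup) :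
    ∀ i x, vec l i = some x → vec l' i = some x := by
  induction h with
  | slnil => simp
  | cons v h ih =>
    rename_i l1 l2
    simp only [List.map_cons, List.nodup_cons] at hn
    intro i x hx
    have h2 := ih hn.2 i x hx
    have : i ≠ v.1 := by
      rintro rfl
      rw [vec_notMem _ _ hn.1] at h2
      simp at h2
    simp [vec, this, h2]
  | cons_cons v h ih =>
    simp only [List.map_cons, List.nodup_cons] at hn
    intro i x hx
    by_cases hi : i = v.1
    · subst hi; simpa [vec] using hx
    · simp only [vec, Function.update_of_ne hi] at hx ⊢
      exact ih hn.2 i x hx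

theorem tucker [NeZero r] (hr : 2 ≤ r) [Fintype ι] (s : (ι → Option (ZMod r)) → ZMod r)
    (h : (ι → Option (ZMod r)) → ℕ)
    (hs : ∀ x X, (∃ i, X i ≠ none) → s (fun i => (X i).map (x + ·)) = x + s X)
    (hpos : ∀ X, (∃ i, X i ≠ none) → 1 ≤ h X)
    (hmono : ∀ X Y : ι → Option (ZMod r), (∃ i, X i ≠ none) →
      (∀ i x, X i = some x → Y i = some x) → h X ≤ h Y)
    (heq : ∀ X Y : ι → Option (ZMod r), (∃ i, X i ≠ none) →
      (∀ i x, X i = some x → Y i = some x) → h X = h Y → s X = s Y)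
    (hι : Nonempty ι) : ∃ X, (∃ i, X i ≠ none) ∧ Fintype.card ι ≤ h X := by
  have : Fact (1 < r) := ⟨hr⟩
  obtain ⟨l, hl⟩ : ∃ l, l = (univ : Finset ι).toList := ⟨_, rfl⟩
  have hlen : l.length = Fintype.card ι := by simp [hl]
  have hnd : l.Nodup := by rw [hl]; exact Finset.nodup_toList _
  cases l with
  | nil => simp at hlen; have := Fintype.card_pos (α := ι); omega
  | cons a l =>
    have h1 := aug_sig (fun L => s (vec L)) (fun x L hL => by
      simp only [vec_map]
      exact hs x _ (vec_ne L hL)) a l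
    obtain ⟨L, hL, hne⟩ := exists_of_linear (Phi (fun L => s (vec L)) (l.length + 1))
      (sig (a :: l)) (by intro h0; rw [h0] at h1; simp at h1)
    have hL2 := sig_support _ L hL
    have hL3 : L.length = l.length + 1 := by
      rw [← List.length_map (f := Prod.fst), hL2]; simp
    have := chain_bound (fun L => s (vec L)) (fun L => h (vec L))
      (fun L hL _ => hpos _ (vec_ne L hL))
      (fun L L' hL hsub hn => hmono _ _ (vec_ne L hL) (vec_mono L L' hsub hn))
      (fun L L' hL hsub hn he => heq _ _ (vec_ne L hL) (vec_mono L L' hsub hn) he)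
      l.length L hL3 (by rw [hL2]; exact hnd) hne
    refine ⟨vec L, vec_ne L (by rintro rfl; simp at hL3), ?_⟩
    rw [← hlen]
    simpa using this

end tucker

section comb
variable {ι : Type*} [LinearOrder ι]

/-- consecutive elements of `D` have different values -/
def Alt {α : Type*} (D : Finset ι) (f : ι → α) : Prop :=
  ∀ i ∈ D, ∀ j ∈ D, i < j → (∀ k ∈ D, ¬ (i < k ∧ k < j)) → f i ≠ f j

/-- the combinatorial statement proved by induction over the sign set `α` -/
def PP (ι : Type*) [LinearOrder ι] (α : Type*) [Fintype α] : Prop :=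
  ∀ (S : Finset ι) (F : Set (Finset ι)) (t : ℕ) (c : Finset ι → ℕ),
    (∀ A ∈ F, A.Nonempty) → (∀ A ∈ F, A ⊆ S → c A < t) →
    (∀ A : α → Finset ι, (∀ i, A i ∈ F ∧ A i ⊆ S) → (∀ i j, i ≠ j → Disjoint (A i) (A j)) →
      ¬ ∃ k, ∀ i, c (A i) = k) →
    ∃ (D : Finset ι) (f : ι → α), D ⊆ S ∧ Alt D f ∧
      (∀ A ∈ F, ∀ a, ¬ (A ⊆ D ∧ ∀ i ∈ A, f i = a)) ∧
      S.card ≤ D.card + (Fintype.card α - 1) * t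

theorem PP.congr {α β : Type*} [Fintype α] [Fintype β] (e : α ≃ β) (h : PP ι α) : PP ι β := by
  intro S F t c h1 h2 h3
  obtain ⟨D, f, hD, hA, hF, hc⟩ := h S F t c h1 h2 (by
    intro A hA hd ⟨k, hk⟩
    exact h3 (fun b => A (e.symm b)) (fun b => hA _) (fun i j hij => hd _ _ (by simpa using hij))
      ⟨k, fun i => hk _⟩)
  refine ⟨D, fun i => e (f i), hD, ?_, ?_, ?_⟩
  · intro i hi j hj hij hk
    simpa using hA i hi j hj hij hk
  · rintro A hA b ⟨hAD, hb⟩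
    exact hF A hA (e.symm b) ⟨hAD, fun i hi => by rw [← hb i hi]; simp⟩
  · rw [← Fintype.card_congr e]; exact hc

theorem PP.prod {α β : Type*} [Fintype α] [Fintype β] [Nonempty α] [Nonempty β]
    (ha : PP ι α) (hb : PP ι β) : PP ι (α × β) := by
  classical
  intro S F t c h1 h2 h3
  let Good : Finset ι → Prop := fun A => ∃ (D : Finset ι) (f : ι → α), D ⊆ A ∧ Alt D f ∧
      (∀ B ∈ F, ∀ a, ¬ (B ⊆ D ∧ ∀ i ∈ B, f i = a)) ∧
      A.card ≤ D.card + (Fintype.card α - 1) * t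
  let T : Set (Finset ι) := {A | A ⊆ S ∧ ¬ Good A}
  have hT : ∀ A, A ∈ T → ∃ (B : α → Finset ι) (k : ℕ), (∀ i, B i ∈ F ∧ B i ⊆ A) ∧
      (∀ i j, i ≠ j → Disjoint (B i) (B j)) ∧ ∀ i, c (B i) = k := by
    rintro A ⟨hAS, hA⟩
    by_contra hcon
    apply hA
    apply ha A F t c h1 (fun B hB hBA => h2 B hB (hBA.trans hAS))
    intro B hB hd ⟨k, hk⟩
    exact hcon ⟨B, k, hB, hd, hk⟩
  choose! B c' hB hd hc' using hT
  have hTne : ∀ A ∈ T, A.Nonempty := by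
    rintro A ⟨hAS, hA⟩
    rw [Finset.nonempty_iff_ne_empty]
    rintro rfl
    apply hA
    refine ⟨∅, fun _ => Classical.arbitrary α, by simp, by intro i hi; simp at hi, ?_, by simp⟩
    rintro B hB a ⟨hBe, _⟩
    have := h1 B hB
    rw [Finset.subset_empty.1 hBe] at this
    simp at this
  obtain ⟨D, g, hDS, hDA, hDT, hDc⟩ := hb S T t c' hTne (by
    intro A hA hAS
    have i0 := Classical.arbitrary α
    rw [← hc' A hA i0]
    exact h2 _ (hB A hA i0).1 ((hB A hA i0).2.trans hAS)) (by
    rintro A hA hdA ⟨k, hk⟩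
    refine h3 (fun q => B (A q.2) q.1) (fun q => ⟨(hB _ (hA q.2).1 q.1).1,
      (hB _ (hA q.2).1 q.1).2.trans (hA q.2).2⟩) ?_ ⟨k, fun q => by
        rw [hc' _ (hA q.2).1, hk]⟩
    rintro ⟨a, b⟩ ⟨a', b'⟩ hne
    by_cases hbb : b = b'
    · subst hbb
      apply hd _ (hA b).1
      rintro rfl; exact hne rfl
    · exact Disjoint.mono (hB _ (hA b).1 a).2 (hB _ (hA b').1 a').2 (hdA b b' hbb))
  have hgood : ∀ b, Good (D.filter fun i => g i = b) := by
    intro b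
    by_contra hng
    have hsub : (D.filter fun i => g i = b) ⊆ S := (Finset.filter_subset _ _).trans hDS
    exact hDT _ ⟨hsub, hng⟩ b ⟨Finset.filter_subset _ _, fun i hi => (Finset.mem_filter.1 hi).2⟩
  choose E f hED hEA hEF hEc using hgood
  have hEg : ∀ b, ∀ i ∈ E b, g i = b := fun b i hi => (Finset.mem_filter.1 (hED b hi)).2
  let Z : Finset ι := univ.biUnion E
  have hZ : ∀ i, i ∈ Z ↔ i ∈ E (g i) := by
    intro i
    simp only [Z, mem_biUnion, mem_univ, true_and]
    constructor
    · rintro ⟨b, hb⟩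
      rwa [hEg b i hb]
    · intro h; exact ⟨_, h⟩
  refine ⟨Z, fun i => (f (g i) i, g i), ?_, ?_, ?_, ?_⟩
  · intro i hi
    rw [hZ] at hi
    exact hDS (Finset.mem_filter.1 (hED _ hi)).1
  · intro i hi j hj hij hbet heq
    simp only [Prod.mk.injEq] at heq
    obtain ⟨h4, h5⟩ := heq
    rw [hZ] at hi hj
    rw [← h5] at h4 hj
    refine hEA (g i) i hi j hj hij ?_ h4
    intro k hk
    apply hbet
    rw [hZ, hEg _ _ hk]
    exact hk
  · rintro A hA ⟨a, b⟩ ⟨hAZ, hAe⟩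
    refine hEF b A hA a ⟨?_, ?_⟩
    · intro i hi
      have h4 := hAZ hi
      have h5 := hAe i hi
      simp only [Prod.mk.injEq] at h5
      rw [hZ, h5.2] at h4
      exact h4
    · intro i hi
      have h5 := hAe i hi
      simp only [Prod.mk.injEq] at h5
      rw [← h5.2]
      exact h5.1
  · have hcardZ : Z.card = ∑ b, (E b).card := by
      apply Finset.card_biUnion
      intro b _ b' _ hbb
      rw [Function.onFun, Finset.disjoint_left]
      intro i hi hi'
      exact hbb ((hEg b i hi).symm.trans (hEg b' i hi'))
    have hcardD : D.card = ∑ b, (D.filter fun i => g i = b).card :=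
      Finset.card_eq_sum_card_fiberwise (fun i _ => by simp)
    have hle : D.card ≤ Z.card + Fintype.card β * ((Fintype.card α - 1) * t) := by
      rw [hcardD, hcardZ]
      calc _ ≤ ∑ b : β, ((E b).card + (Fintype.card α - 1) * t) :=
            Finset.sum_le_sum (fun b _ => hEc b)
        _ = _ := by simp [Finset.sum_add_distrib]
    have hα : 0 < Fintype.card α := Fintype.card_pos
    have hβ : 0 < Fintype.card β := Fintype.card_pos
    rw [Fintype.card_prod]
    obtain ⟨x, hx⟩ := Nat.exists_eq_succ_of_ne_zero hα.ne'
    obtain ⟨y, hy⟩ := Nat.exists_eq_succ_of_ne_zero hβ.ne'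
    rw [hx] at hle ⊢
    rw [hy] at hle hDc ⊢
    have e1 : (x.succ * y.succ - 1) = y + y.succ * x := by
      simp only [Nat.succ_eq_add_one]
      rw [Nat.sub_eq_of_eq_add]; ring
    rw [e1]
    simp only [Nat.succ_eq_add_one, Nat.add_sub_cancel] at hle hDc ⊢
    nlinarith

end comb

section prime
variable {ι : Type*} [LinearOrder ι] [Fintype ι] {r : ℕ} [NeZero r]

/-- length of the longest alternating subset of the support -/
noncomputable def altL (X : ι → Option (ZMod r)) : ℕ := by
  classical
  exact (univ.filter fun D : Finset ι => (∀ i ∈ D, X i ≠ none) ∧ Alt D X).sup Finset.card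

theorem le_altL (X : ι → Option (ZMod r)) (D : Finset ι) (h1 : ∀ i ∈ D, X i ≠ none)
    (h2 : Alt D X) : D.card ≤ altL X := by
  classical
  unfold altL
  exact Finset.le_sup (f := Finset.card) (by simp only [mem_filter, mem_univ, true_and]; exact ⟨h1, h2⟩)

theorem exists_altL (X : ι → Option (ZMod r)) :
    ∃ D : Finset ι, (∀ i ∈ D, X i ≠ none) ∧ Alt D X ∧ D.card = altL X := by
  classical
  unfold altL
  obtain ⟨D, hD, he⟩ := Finset.exists_mem_eq_sup
    (univ.filter fun D : Finset ι => (∀ i ∈ D, X i ≠ none) ∧ Alt D X)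
    ⟨∅, by simp [Alt]⟩ Finset.card
  simp only [mem_filter, mem_univ, true_and] at hD
  exact ⟨D, hD.1, hD.2, he.symm⟩

theorem Alt.congr {α β : Type*} {D : Finset ι} {f : ι → α} {g : ι → β} (h : Alt D f)
    (hfg : ∀ i ∈ D, ∀ j ∈ D, g i = g j → f i = f j) : Alt D g := by
  intro i hi j hj hij hk he
  exact h i hi j hj hij hk (hfg i hi j hj he)

theorem altL_pos (X : ι → Option (ZMod r)) (h : ∃ i, X i ≠ none) : 1 ≤ altL X := by
  obtain ⟨i, hi⟩ := h
  have := le_altL X {i} (by simpa using hi) (by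
    intro a ha b hb hab
    simp only [mem_singleton] at ha hb
    subst ha; subst hb; exact absurd hab (lt_irrefl _))
  simpa using this

theorem ext_eq {X Y : ι → Option (ZMod r)} (h : ∀ i x, X i = some x → Y i = some x) (i : ι)
    (hi : X i ≠ none) : Y i = X i := by
  obtain ⟨x, hx⟩ := Option.ne_none_iff_exists'.1 hi
  rw [hx]; exact h i x hx

theorem altL_mono (X Y : ι → Option (ZMod r)) (h : ∀ i x, X i = some x → Y i = some x) :
    altL X ≤ altL Y := by
  obtain ⟨D, h1, h2, h3⟩ := exists_altL X
  rw [← h3]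
  refine le_altL Y D ?_ (h2.congr ?_)
  · intro i hi; rw [ext_eq h i (h1 i hi)]; exact h1 i hi
  · intro i hi j hj; rw [ext_eq h i (h1 i hi), ext_eq h j (h1 j hj)]; exact id

/-- first nonzero entry -/
noncomputable def firstV (X : ι → Option (ZMod r)) : Option (ZMod r) := by
  classical
  exact if h : (univ.filter fun i => X i ≠ none).Nonempty then
    X ((univ.filter fun i => X i ≠ none).min' h) else none

theorem firstV_spec (X : ι → Option (ZMod r)) (h : ∃ i, X i ≠ none) :
    ∃ m, X m ≠ none ∧ (∀ i, X i ≠ none → m ≤ i) ∧ firstV X = X m := by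
  classical
  have hne : (univ.filter fun i => X i ≠ none).Nonempty := by
    obtain ⟨i, hi⟩ := h
    exact ⟨i, by simpa using hi⟩
  refine ⟨(univ.filter fun i => X i ≠ none).min' hne, ?_, ?_, ?_⟩
  · have := Finset.min'_mem _ hne
    simpa using this
  · intro i hi
    exact Finset.min'_le _ _ (by simpa using hi)
  · unfold firstV
    rw [dif_pos hne]

theorem firstV_eq (X : ι → Option (ZMod r)) (m : ι) (h1 : X m ≠ none)
    (h2 : ∀ i, X i ≠ none → m ≤ i) : firstV X = X m := by
  obtain ⟨m', h3, h4, h5⟩ := firstV_spec X ⟨m, h1⟩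
  rw [h5, le_antisymm (h2 _ h3) (h4 _ h1)]

/-- the first entry of a longest alternating set agrees with the first nonzero entry -/
theorem firstV_alt (Y : ι → Option (ZMod r)) (D : Finset ι) (hD : D.Nonempty)
    (h1 : ∀ i ∈ D, Y i ≠ none) (h2 : Alt D Y) (h3 : D.card = altL Y) :
    firstV Y = Y (D.min' hD) := by
  classical
  obtain ⟨m, h4, h5, h6⟩ := firstV_spec Y ⟨_, h1 _ (D.min'_mem hD)⟩
  rw [h6]
  by_contra hne
  have hle : m ≤ D.min' hD := h5 _ (h1 _ (D.min'_mem hD))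
  have hlt : m < D.min' hD := lt_of_le_of_ne hle (by rintro rfl; exact hne rfl)
  have hall : ∀ i ∈ D, m < i := fun i hi => lt_of_lt_of_le hlt (D.min'_le i hi)
  have hm : m ∉ D := fun hm => lt_irrefl _ (hall m hm)
  have := le_altL Y (insert m D) (by
    intro i hi
    rcases Finset.mem_insert.1 hi with rfl | hi
    · exact h4
    · exact h1 i hi) (by
    intro i hi j hj hij hbet
    rcases Finset.mem_insert.1 hj with rfl | hjD
    · rcases Finset.mem_insert.1 hi with rfl | hiD
      · exact absurd hij (lt_irrefl _)
      · exact absurd hij (not_lt.2 (hall i hiD).le)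
    · rcases Finset.mem_insert.1 hi with rfl | hiD
      · have : j = D.min' hD := by
          by_contra hj'
          have h7 : D.min' hD < j := lt_of_le_of_ne (D.min'_le j hjD) (Ne.symm hj')
          exact hbet _ (Finset.mem_insert_of_mem (D.min'_mem hD)) ⟨hlt, h7⟩
        rw [this]; exact hne
      · exact h2 i hiD j hjD hij (fun k hk => hbet k (Finset.mem_insert_of_mem hk)))
  rw [Finset.card_insert_of_notMem hm] at this
  omega

theorem firstV_mono (X Y : ι → Option (ZMod r)) (hX : ∃ i, X i ≠ none)
    (h : ∀ i x, X i = some x → Y i = some x) (he : altL X = altL Y) : firstV X = firstV Y := by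
  obtain ⟨D, h1, h2, h3⟩ := exists_altL X
  have hD : D.Nonempty := by
    rw [← Finset.card_pos, h3]; exact altL_pos X hX
  rw [firstV_alt X D hD h1 h2 h3, firstV_alt Y D hD ?_ ?_ (h3.trans he)]
  · exact (ext_eq h _ (h1 _ (D.min'_mem hD))).symm
  · intro i hi; rw [ext_eq h i (h1 i hi)]; exact h1 i hi
  · apply h2.congr
    intro i hi j hj; rw [ext_eq h i (h1 i hi), ext_eq h j (h1 j hj)]; exact id

theorem firstV_act (X : ι → Option (ZMod r)) (hX : ∃ i, X i ≠ none) (x : ZMod r) :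
    firstV (fun i => (X i).map (x + ·)) = (firstV X).map (x + ·) := by
  obtain ⟨m, h1, h2, h3⟩ := firstV_spec X hX
  rw [h3]
  apply firstV_eq
  · simpa using h1
  · intro i hi
    apply h2
    simpa using hi

/-- the level of `c` in `S` -/
def lev (S : Finset (ZMod r × ℕ)) (c : ℕ) : Finset (ZMod r) :=
  univ.filter fun g => (g, c) ∈ S

noncomputable def minc (S : Finset (ZMod r × ℕ)) : ℕ := sInf {c | (lev S c).Nonempty}

/-- equivariant selector on sets with proper levels -/
noncomputable def sel (S : Finset (ZMod r × ℕ)) : ZMod r :=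
  (∑ g ∈ lev S (minc S), g) * ((lev S (minc S)).card : ZMod r)⁻¹

theorem sel_act [Fact r.Prime] (S S' : Finset (ZMod r × ℕ)) (x : ZMod r)
    (hS' : ∀ g c, (x + g, c) ∈ S' ↔ (g, c) ∈ S)
    (hne : S.Nonempty) (hlev : ∀ c, lev S c ≠ univ) : sel S' = x + sel S := by
  classical
  have h1 : ∀ c, lev S' c = (lev S c).map (Equiv.addLeft x).toEmbedding := by
    intro c
    ext g
    simp only [lev, mem_filter, mem_univ, true_and, mem_map, Equiv.toEmbedding_apply,
      Equiv.coe_addLeft]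
    constructor
    · intro h
      refine ⟨-x + g, ?_, by simp⟩
      rw [← hS']
      simpa using h
    · rintro ⟨g', h, rfl⟩
      exact (hS' _ _).2 h
  have h2 : minc S' = minc S := by
    unfold minc
    congr 1
    ext c
    simp [h1]
  have h3 : (lev S (minc S)).Nonempty := by
    have : {c | (lev S c).Nonempty}.Nonempty := by
      obtain ⟨⟨g, c⟩, h⟩ := hne
      exact ⟨c, g, by simpa [lev] using h⟩
    exact Nat.sInf_mem this
  have h4 : (lev S (minc S)).card < r := by
    have := Finset.card_lt_card (Finset.ssubset_univ_iff.2 (hlev (minc S)))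
    rwa [Finset.card_univ, ZMod.card] at this
  have h5 : ((lev S (minc S)).card : ZMod r) ≠ 0 := by
    intro h0
    rw [ZMod.natCast_eq_zero_iff] at h0
    have := Nat.le_of_dvd (Finset.card_pos.2 h3) h0
    omega
  unfold sel
  rw [h2, h1, Finset.sum_map, Finset.card_map]
  simp only [Equiv.toEmbedding_apply, Equiv.coe_addLeft, Finset.sum_add_distrib, Finset.sum_const,
    nsmul_eq_mul]
  field_simp
  rw [Finset.sum_add_distrib, Finset.sum_const, nsmul_eq_mul]
  ring

theorem tuckerS (hr : 2 ≤ r) (S : Finset ι) (s : (ι → Option (ZMod r)) → ZMod r)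
    (h : (ι → Option (ZMod r)) → ℕ)
    (hs : ∀ x X, (∃ i, X i ≠ none) → (∀ i, X i ≠ none → i ∈ S) →
      s (fun i => (X i).map (x + ·)) = x + s X)
    (hpos : ∀ X, (∃ i, X i ≠ none) → 1 ≤ h X)
    (hmono : ∀ X Y : ι → Option (ZMod r), (∃ i, X i ≠ none) → (∀ i, Y i ≠ none → i ∈ S) →
      (∀ i x, X i = some x → Y i = some x) → h X ≤ h Y)
    (heq : ∀ X Y : ι → Option (ZMod r), (∃ i, X i ≠ none) → (∀ i, Y i ≠ none → i ∈ S) →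
      (∀ i x, X i = some x → Y i = some x) → h X = h Y → s X = s Y)
    (hS : S.Nonempty) :
    ∃ X, (∃ i, X i ≠ none) ∧ (∀ i, X i ≠ none → i ∈ S) ∧ S.card ≤ h X := by
  let e : (S → Option (ZMod r)) → ι → Option (ZMod r) :=
    fun X i => if hi : i ∈ S then X ⟨i, hi⟩ else none
  have e1 : ∀ X, (∃ i, X i ≠ none) → ∃ i, e X i ≠ none := by
    rintro X ⟨⟨i, hi⟩, h⟩
    exact ⟨i, by simpa [e, hi] using h⟩
  have e2 : ∀ X i, e X i ≠ none → i ∈ S := by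
    intro X i h
    by_contra hi
    simp [e, hi] at h
  have e3 : ∀ X Y : S → Option (ZMod r), (∀ i x, X i = some x → Y i = some x) →
      ∀ i x, e X i = some x → e Y i = some x := by
    intro X Y h i x hx
    by_cases hi : i ∈ S
    · simp only [e, hi, dif_pos] at hx ⊢
      exact h _ _ hx
    · simp [e, hi] at hx
  obtain ⟨X, h1, h2⟩ := tucker (ι := S) hr (fun X => s (e X)) (fun X => h (e X))
    (by
      intro x X hX
      have : e (fun i => (X i).map (x + ·)) = fun i => (e X i).map (x + ·) := by
        ext1 i
        by_cases hi : i ∈ S <;> simp [e, hi]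
      rw [this]
      exact hs x _ (e1 X hX) (e2 X))
    (fun X hX => hpos _ (e1 X hX))
    (fun X Y hX hXY => hmono _ _ (e1 X hX) (e2 Y) (e3 X Y hXY))
    (fun X Y hX hXY => heq _ _ (e1 X hX) (e2 Y) (e3 X Y hXY))
    hS.to_subtype
  exact ⟨e X, e1 X h1, e2 X, by simpa using h2⟩

theorem PP.prime (hp : r.Prime) : PP ι (ZMod r) := by
  classical
  haveI : Fact r.Prime := ⟨hp⟩
  intro S F t c hne hct hmon
  rw [ZMod.card]
  by_contra hcon
  push Not at hcon
  have hS : S.Nonempty := by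
    rw [Finset.nonempty_iff_ne_empty]
    rintro rfl
    have := hcon ∅ (fun _ => 0) (by simp) (by intro i hi; simp at hi) (by
      rintro A hA a hAe
      have := hne A hA
      rw [Finset.subset_empty.1 hAe] at this
      simp at this)
    simp at this
  -- colour data
  let Q : (ι → Option (ZMod r)) → Finset (ZMod r × ℕ) := fun X =>
    (univ ×ˢ range t).filter fun q => ∃ A ∈ F, A ⊆ S ∧ (∀ i ∈ A, X i = some q.1) ∧ c A = q.2
  have hQ : ∀ X g k, (g, k) ∈ Q X ↔ ∃ A ∈ F, A ⊆ S ∧ (∀ i ∈ A, X i = some g) ∧ c A = k := by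
    intro X g k
    simp only [Q, mem_filter, mem_product, mem_univ, true_and, mem_range]
    constructor
    · exact fun h => h.2
    · intro h
      refine ⟨?_, h⟩
      obtain ⟨A, hA, hAS, _, rfl⟩ := h
      exact hct A hA hAS
  have hlev : ∀ X k, lev (Q X) k ≠ univ := by
    intro X k hk
    have h1 : ∀ g, ∃ A ∈ F, A ⊆ S ∧ (∀ i ∈ A, X i = some g) ∧ c A = k := by
      intro g
      rw [← hQ]
      have : g ∈ lev (Q X) k := by rw [hk]; simp
      simpa [lev] using this
    choose A hA hAS hAX hAc using h1
    refine hmon A (fun i => ⟨hA i, hAS i⟩) ?_ ⟨k, hAc⟩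
    intro g g' hgg
    rw [Finset.disjoint_left]
    intro i hi hi'
    have := (hAX g i hi).symm.trans (hAX g' i hi')
    exact hgg (Option.some.inj this)
  have hcard : ∀ X, (Q X).card ≤ (r - 1) * t := by
    intro X
    have h1 : (Q X).card = ∑ k ∈ range t, ((Q X).filter fun q => q.2 = k).card :=
      Finset.card_eq_sum_card_fiberwise (fun q hq => by
        have := (Finset.mem_filter.1 hq).1
        exact (Finset.mem_product.1 this).2)
    rw [h1]
    calc _ ≤ ∑ k ∈ range t, (r - 1) := by
          apply Finset.sum_le_sum
          intro k _
          have h2 : ((Q X).filter fun q => q.2 = k).card ≤ (lev (Q X) k).card := by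
            apply Finset.card_le_card_of_injOn Prod.fst
            · rintro ⟨g, k'⟩ hq
              simp only [coe_filter, Set.mem_setOf_eq] at hq
              obtain ⟨hq, rfl⟩ := hq
              simpa [lev] using hq
            · rintro ⟨g, k1⟩ hq ⟨g', k2⟩ hq' hgg
              simp only [coe_filter, Set.mem_setOf_eq] at hq hq'
              obtain ⟨_, rfl⟩ := hq
              obtain ⟨_, rfl⟩ := hq'
              simp only at hgg
              rw [hgg]
          have h3 : (lev (Q X) k).card < r := by
            have := Finset.card_lt_card (Finset.ssubset_univ_iff.2 (hlev X k))
            rwa [Finset.card_univ, ZMod.card] at this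
          omega
      _ = _ := by simp [mul_comm]
  have hQmono : ∀ X Y : ι → Option (ZMod r), (∀ i x, X i = some x → Y i = some x) →
      Q X ⊆ Q Y := by
    rintro X Y h ⟨g, k⟩ hq
    rw [hQ] at hq ⊢
    obtain ⟨A, hA, hAS, hAX, hAc⟩ := hq
    exact ⟨A, hA, hAS, fun i hi => h _ _ (hAX i hi), hAc⟩
  -- bound on alternation
  have halt : ∀ X : ι → Option (ZMod r), (∀ i, X i ≠ none → i ∈ S) → Q X = ∅ →
      altL X + (r - 1) * t < S.card := by
    intro X hXS hX
    obtain ⟨D, h1, h2, h3⟩ := exists_altL X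
    rw [← h3]
    have hget : ∀ i ∈ D, X i = some ((X i).getD 0) := by
      intro i hi
      obtain ⟨x, hx⟩ := Option.ne_none_iff_exists'.1 (h1 i hi)
      simp [hx]
    apply hcon D (fun i => (X i).getD 0) (fun i hi => hXS i (h1 i hi))
    · apply h2.congr
      intro i hi j hj hij
      rw [hget i hi, hget j hj, hij]
    · intro A hA a hAD
      by_contra hall
      push Not at hall
      have : (a, c A) ∈ Q X := by
        rw [hQ]
        refine ⟨A, hA, fun i hi => hXS i (h1 i (hAD hi)), fun i hi => ?_, rfl⟩
        rw [hget i (hAD hi), hall i hi]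
      rw [hX] at this
      simp at this
  have hlt : (r - 1) * t < S.card := by
    have h0 : Q (fun _ => none) = ∅ := by
      rw [Finset.eq_empty_iff_forall_notMem]
      rintro ⟨g, k⟩ hq
      rw [hQ] at hq
      obtain ⟨A, hA, _, hAX, _⟩ := hq
      obtain ⟨i, hi⟩ := hne A hA
      simpa using hAX i hi
    have := halt (fun _ => none) (by simp) h0
    omega
  obtain ⟨a, ha⟩ : ∃ a, a + 1 + (r - 1) * t = S.card := ⟨S.card - (r - 1) * t - 1, by omega⟩
  obtain ⟨X, hX1, hX2, hX3⟩ := tuckerS hp.two_le S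
    (fun X => if Q X = ∅ then (firstV X).getD 0 else sel (Q X))
    (fun X => if Q X = ∅ then altL X else a + (Q X).card)
    (by
      intro x X hX hXS
      have hact : ∀ g k, (x + g, k) ∈ Q (fun i => (X i).map (x + ·)) ↔ (g, k) ∈ Q X := by
        intro g k
        rw [hQ, hQ]
        simp
      have hemp : Q (fun i => (X i).map (x + ·)) = ∅ ↔ Q X = ∅ := by
        simp only [Finset.eq_empty_iff_forall_notMem, Prod.forall, ← hact]
        constructor
        · intro h g k; exact h _ _
        · intro h g k
          have := h (-x + g) k
          simpa using this
      by_cases h0 : Q X = ∅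
      · simp only [h0, hemp.2 h0, if_true]
        rw [firstV_act X hX]
        obtain ⟨m, h1, h2, h3⟩ := firstV_spec X hX
        obtain ⟨y, hy⟩ := Option.ne_none_iff_exists'.1 h1
        simp [h3, hy]
      · have h0' : ¬ Q (fun i => (X i).map (x + ·)) = ∅ := fun h => h0 (hemp.1 h)
        simp only [h0, h0', if_false]
        exact sel_act _ _ x hact (Finset.nonempty_iff_ne_empty.2 h0) (hlev X))
    (by
      intro X hX
      by_cases h0 : Q X = ∅
      · simp only [h0, if_true]; exact altL_pos X hX
      · simp only [h0, if_false]
        have := Finset.card_pos.2 (Finset.nonempty_iff_ne_empty.2 h0)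
        omega)
    (by
      intro X Y hX hYS hXY
      have hsub := hQmono X Y hXY
      by_cases hY : Q Y = ∅
      · have hX0 : Q X = ∅ := Finset.subset_empty.1 (hY ▸ hsub)
        simp only [hX0, hY, if_true]
        exact altL_mono X Y hXY
      · by_cases hX0 : Q X = ∅
        · simp only [hX0, hY, if_true, if_false]
          have := halt X (fun i hi => hYS i (by rw [ext_eq hXY i hi]; exact hi)) hX0
          omega
        · simp only [hX0, hY, if_false]
          have := Finset.card_le_card hsub
          omega)
    (by
      intro X Y hX hYS hXY
      have hsub := hQmono X Y hXY
      by_cases hY : Q Y = ∅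
      · have hX0 : Q X = ∅ := Finset.subset_empty.1 (hY ▸ hsub)
        simp only [hX0, hY, if_true]
        intro he
        rw [firstV_mono X Y hX hXY he]
      · by_cases hX0 : Q X = ∅
        · simp only [hX0, hY, if_true, if_false]
          have h1 := halt X (fun i hi => hYS i (by rw [ext_eq hXY i hi]; exact hi)) hX0
          have h2 := Finset.card_pos.2 (Finset.nonempty_iff_ne_empty.2 hY)
          intro he
          omega
        · simp only [hX0, hY, if_false]
          intro he
          rw [Finset.eq_of_subset_of_card_le hsub (by omega)])
    hS
  by_cases h0 : Q X = ∅
  · simp only [h0, if_true] at hX3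
    have := halt X hX2 h0
    omega
  · simp only [h0, if_false] at hX3
    have := hcard X
    omega

theorem PP.all : ∀ r : ℕ, 2 ≤ r → PP ι (Fin r) := by
  intro r
  induction r using Nat.strong_induction_on with
  | _ r ih =>
    intro hr
    by_cases hp : r.Prime
    · haveI : NeZero r := ⟨hp.ne_zero⟩
      exact PP.congr (ZMod.finEquiv r).symm.toEquiv (PP.prime hp)
    · obtain ⟨a, b, ha, hb, rfl⟩ : ∃ a b, a < r ∧ b < r ∧ r = a * b := by
        obtain ⟨a, h1, h2, h3⟩ := Nat.exists_dvd_of_not_prime2 hr hp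
        obtain ⟨b, rfl⟩ := h1
        refine ⟨a, b, h3, ?_, rfl⟩
        have : 0 < b := by
          rcases Nat.eq_zero_or_pos b with rfl | h
          · simp at hr
          · exact h
        nlinarith
      have ha2 : 2 ≤ a := by
        rcases a with _ | _ | a
        · simp at hr
        · simp at hb
        · omega
      have hb2 : 2 ≤ b := by
        rcases b with _ | _ | b
        · simp at hr
        · simp at ha
        · omega
      haveI : Nonempty (Fin a) := ⟨⟨0, by omega⟩⟩
      haveI : Nonempty (Fin b) := ⟨⟨0, by omega⟩⟩
      exact PP.congr finProdFinEquiv (PP.prod (ih a ha ha2) (ih b hb hb2))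

end prime

end KH

theorem altVec_bdd {α : Type*} (n : ℕ) (σ : Equiv.Perm (Fin n)) (X : Fin n → Option α)
    (k : ℕ) (hk : ∃ l : List (Fin n), IsAltList n σ X l ∧ l.length = k) : k ≤ n := by
  obtain ⟨l, h, rfl⟩ := hk
  have h1 : l.Pairwise (· < ·) := List.isChain_iff_pairwise.1 h.1
  have h2 : l.Nodup := h1.imp (fun h => ne_of_lt h)
  simpa using h2.length_le_card

theorem altVec_le {α : Type*} (n : ℕ) (σ : Equiv.Perm (Fin n)) (X : Fin n → Option α) :
    altVec n σ X ≤ n :=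
  csSup_le' (fun k hk => altVec_bdd n σ X k hk)

theorem le_altVec {α : Type*} (n : ℕ) (σ : Equiv.Perm (Fin n)) (X : Fin n → Option α)
    (D : Finset (Fin n)) (h1 : ∀ i ∈ D, X (σ i) ≠ none) (h2 : KH.Alt D (fun i => X (σ i))) :
    D.card ≤ altVec n σ X := by
  apply le_csSup ⟨n, fun k hk => altVec_bdd n σ X k hk⟩
  have hs : D.sort.Pairwise (· < ·) := (Finset.sortedLT_sort D).pairwise
  refine ⟨D.sort, ⟨List.isChain_iff_pairwise.2 hs, fun i hi => h1 i (by simpa using hi), ?_⟩,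
    by simp⟩
  refine List.isChain_iff_getElem.2 ?_
  intro i hi
  have hlt : ∀ (a b : ℕ) (ha : a < D.sort.length) (hb : b < D.sort.length), a < b →
      D.sort[a] < D.sort[b] := fun a b ha hb hab => List.pairwise_iff_getElem.1 hs a b ha hb hab
  apply h2 _ (by rw [← Finset.mem_sort (r := (· ≤ ·))]; exact List.getElem_mem _) _
    (by rw [← Finset.mem_sort (r := (· ≤ ·))]; exact List.getElem_mem _) (hlt _ _ _ _ (by omega))
  rintro k hk ⟨hk1, hk2⟩
  rw [← Finset.mem_sort (r := (· ≤ ·))] at hk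
  obtain ⟨m, hm, rfl⟩ := List.getElem_of_mem hk
  have h3 : i < m := by
    by_contra hc
    rcases Nat.lt_or_eq_of_le (not_lt.1 hc) with h | h
    · exact lt_asymm hk1 (hlt _ _ _ _ h)
    · subst h; exact lt_irrefl _ hk1
  have h4 : m < i + 1 := by
    by_contra hc
    rcases Nat.lt_or_eq_of_le (not_lt.1 hc) with h | h
    · exact lt_asymm hk2 (hlt _ _ _ _ h)
    · subst h; exact lt_irrefl _ hk2
  omega

theorem kneser_main (n r t : ℕ) (hr : 2 ≤ r) (F : Finset (Finset (Fin n)))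
    (hF : ∀ A ∈ F, A.Nonempty) (c : Finset (Fin n) → ℕ) (hc : IsKneserColoring n r t F c)
    (σ : Equiv.Perm (Fin n)) : n ≤ altHyp n r σ F + (r - 1) * t := by
  classical
  haveI : NeZero r := ⟨by omega⟩
  obtain ⟨D, f, -, hD2, hD3, hD4⟩ := KH.PP.all (ι := Fin n) r hr univ
    {A | A.map σ.toEmbedding ∈ F} t (fun A => c (A.map σ.toEmbedding) - 1)
    (fun A hA => by simpa using hF _ hA)
    (fun A hA _ => by
      have := Finset.mem_Icc.1 (hc.1 _ hA)
      omega)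
    (by
      rintro A hA hd ⟨k, hk⟩
      have hdis : ∀ i j, i ≠ j → Disjoint ((A i).map σ.toEmbedding) ((A j).map σ.toEmbedding) :=
        fun i j hij => (Finset.disjoint_map _).2 (hd i j hij)
      refine hc.2 (univ.image fun i => (A i).map σ.toEmbedding) ?_ ?_ ?_ ⟨k + 1, ?_⟩
      · intro B hB
        obtain ⟨i, _, rfl⟩ := Finset.mem_image.1 hB
        exact (hA i).1
      · rw [Finset.card_image_of_injective]
        · simp
        · intro i j hij
          by_contra hne
          have h1 := hdis i j hne
          simp only at hij
          rw [hij, disjoint_self] at h1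
          have h2 := hF _ (hA j).1
          rw [h1] at h2
          simp at h2
      · intro B hB B' hB' hne
        simp only [coe_image, coe_univ, Set.image_univ, Set.mem_range] at hB hB'
        obtain ⟨i, rfl⟩ := hB
        obtain ⟨j, rfl⟩ := hB'
        apply hdis
        rintro rfl
        exact hne rfl
      · intro B hB
        obtain ⟨i, _, rfl⟩ := Finset.mem_image.1 hB
        have h1 := Finset.mem_Icc.1 (hc.1 _ (hA i).1)
        have h2 := hk i
        omega)
  simp only [Finset.card_univ, Fintype.card_fin] at hD4
  rcases D.eq_empty_or_nonempty with rfl | hne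
  · simp at hD4; omega
  let X : Fin n → Option (Fin r) := fun a =>
    if σ.symm a ∈ D then some (f (σ.symm a)) else none
  have hX : ∀ i ∈ D, X (σ i) = some (f i) := fun i hi => by simp [X, hi]
  have h1 : D.card ≤ altVec n σ X := by
    apply le_altVec
    · intro i hi; rw [hX i hi]; simp
    · intro i hi j hj hij hb
      simp only
      rw [hX i hi, hX j hj]
      simpa using hD2 i hi j hj hij hb
  have h2 : altVec n σ X ≤ altHyp n r σ F := by
    apply le_csSup
    · refine ⟨n, ?_⟩
      rintro k ⟨Y, _, rfl, _⟩
      exact altVec_le n σ Y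
    · refine ⟨X, ?_, rfl, ?_⟩
      · obtain ⟨i, hi⟩ := hne
        exact ⟨σ i, by rw [hX i hi]; simp⟩
      · intro j A hA hall
        have hmem : ∀ a ∈ A, σ.symm a ∈ D ∧ f (σ.symm a) = j := by
          intro a ha
          have := hall a ha
          by_cases hm : σ.symm a ∈ D
          · simp only [X, hm, if_true, Option.some.injEq] at this
            exact ⟨hm, this⟩
          · simp [X, hm] at this
        have hmm : (A.map σ.symm.toEmbedding).map σ.toEmbedding = A := by
          rw [Finset.map_map]
          ext a
          simp
        refine hD3 (A.map σ.symm.toEmbedding) ?_ j ⟨?_, ?_⟩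
        · rw [Set.mem_setOf_eq, hmm]; exact hA
        · intro i hi
          obtain ⟨a, ha, rfl⟩ := Finset.mem_map.1 hi
          exact (hmem a ha).1
        · intro i hi
          obtain ⟨a, ha, rfl⟩ := Finset.mem_map.1 hi
          exact (hmem a ha).2
  omega

theorem kneser_exists (n r : ℕ) (hr : 2 ≤ r) (F : Finset (Finset (Fin n))) :
    {t | ∃ c, IsKneserColoring n r t F c}.Nonempty := by
  classical
  let e := Fintype.equivFin (Finset (Fin n))
  refine ⟨Fintype.card (Finset (Fin n)), fun A => (e A).val + 1, ?_, ?_⟩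
  · intro A _
    have := (e A).isLt
    exact Finset.mem_Icc.2 ⟨Nat.succ_pos _, this⟩
  · rintro E - hE - ⟨i, hi⟩
    have h1 : 1 < E.card := by omega
    obtain ⟨A, hA, B, hB, hne⟩ := Finset.one_lt_card.1 h1
    apply hne
    apply e.injective
    apply Fin.ext
    have h2 : (e A).val + 1 = i := hi A hA
    have h3 : (e B).val + 1 = i := hi B hB
    omega

theorem stmt0 (n r : ℕ) (hr : 2 ≤ r) (F : Finset (Finset (Fin n)))
    (hF : ∀ A ∈ F, A.Nonempty) :
    ((n : ℚ) - (altNum n r F : ℚ)) / ((r : ℚ) - 1) ≤ (kneserChrom n r F : ℚ) := by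
  obtain ⟨c, hc⟩ := Nat.sInf_mem (kneser_exists n r hr F)
  obtain ⟨σ, hσ⟩ := Nat.sInf_mem
    (⟨_, 1, rfl⟩ : {k | ∃ σ : Equiv.Perm (Fin n), altHyp n r σ F = k}.Nonempty)
  have h := kneser_main n r _ hr F hF c hc σ
  rw [hσ] at h
  change n ≤ altNum n r F + (r - 1) * kneserChrom n r F at h
  have hr' : (0 : ℚ) < (r : ℚ) - 1 := by
    have : (2 : ℚ) ≤ r := by exact_mod_cast hr
    linarith
  rw [div_le_iff₀ hr']
  have h' : (n : ℚ) ≤ altNum n r F + ((r - 1 : ℕ) : ℚ) * kneserChrom n r F := by exact_mod_cast h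
  rw [Nat.cast_sub (by omega)] at h'
  push_cast at h'
  linarith
end

section
/- Let p be a prime number, let F be a hypergraph on vertex set [n] = {1,...,n}, and let i be a positive integer with i ≤ χ(KG^p(F)) + 1. Then χ(KG^p(F)) ≥ (n − alt_p(F, i)) / (p − 1) + i − 1. -/
open Finset

open Classical in
/-- `alt_{p,σ}(F, i)`: the largest `ℓ` such that some nonzero `X ∈ (Z_p ∪ {0})^n` has
`alt_σ(X) = ℓ` and the Kneser hypergraph of `F|_X = {A ∈ F : A ⊆ X^j for some j}` has
chromatic number at most `i - 1`. -/
noncomputable def altHypI (n p : ℕ) (σ : Equiv.Perm (Fin n))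
    (F : Finset (Finset (Fin n))) (i : ℕ) : ℕ :=
  sSup {k | ∃ X : Fin n → Option (Fin p), (∃ a, X a ≠ none) ∧
    altVec n σ X = k ∧
    kneserChrom n p (F.filter fun A => ∃ j : Fin p, ∀ a ∈ A, X a = some j) ≤ i - 1}

/-- `alt_p(F, i) = min_σ alt_{p,σ}(F, i)`. -/
noncomputable def altNumI (n p : ℕ) (F : Finset (Finset (Fin n))) (i : ℕ) : ℕ :=
  sInf {k | ∃ σ : Equiv.Perm (Fin n), altHypI n p σ F i = k}

namespace ZpT

/-- Words in the vertices `(sign, label)`. -/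
abbrev W (p : ℕ) := List (ZMod p × ℕ)

def sh {p : ℕ} (t : ZMod p) (w : W p) : W p := w.map (fun x => (x.1 + t, x.2))

/-- The coboundary on functions of words. -/
def dl {p : ℕ} : (W p → ZMod p) → W p → ZMod p
  | _, [] => 0
  | φ, x :: w => φ w - dl (fun u => φ (x :: u)) w

def op {p : ℕ} [NeZero p] (k : ℕ) (φ : W p → ZMod p) (w : W p) : ZMod p :=
  if Even k then ∑ t : ZMod p, φ (sh t w) else φ (sh 1 w) - φ w

def Fs {p : ℕ} (Λ : W p → ZMod p × ℕ) : ℕ → (W p → ZMod p) → W p → ZMod p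
  | 0, φ, u => if u = [] then φ [] else 0
  | k + 1, φ, u => dl (Fs Λ k (fun w => φ (Λ u :: w))) u

def hh {p : ℕ} [NeZero p] : ℕ → (W p → ZMod p) → ZMod p
  | 0, ψ => ψ [(0, 0)]
  | k + 1, ψ => hh k (op (k + 1) (fun w => ψ ((0, k + 1) :: w)))

section basic
variable {p : ℕ}

lemma sh_zero (w : W p) : sh 0 w = w := by simp [sh]
lemma sh_sh (s t : ZMod p) (w : W p) : sh s (sh t w) = sh (t + s) w := by
  simp [sh, Function.comp_def, add_assoc]
lemma sh_cons (t : ZMod p) (x : ZMod p × ℕ) (w : W p) :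
    sh t (x :: w) = (x.1 + t, x.2) :: sh t w := rfl
lemma sh_nil (t : ZMod p) : sh t ([] : W p) = [] := rfl

lemma dl_zero (w : W p) : dl (fun _ => (0 : ZMod p)) w = 0 := by
  induction w with
  | nil => rfl
  | cons x w ih => simp [dl, ih]

lemma dl_add (φ ψ : W p → ZMod p) (w : W p) :
    dl (fun u => φ u + ψ u) w = dl φ w + dl ψ w := by
  induction w generalizing φ ψ with
  | nil => simp [dl]
  | cons x w ih => simp only [dl, ih]; ring

lemma dl_neg (φ : W p → ZMod p) (w : W p) :
    dl (fun u => - φ u) w = - dl φ w := by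
  induction w generalizing φ with
  | nil => simp [dl]
  | cons x w ih => simp only [dl, ih]; ring

lemma dl_sub (φ ψ : W p → ZMod p) (w : W p) :
    dl (fun u => φ u - ψ u) w = dl φ w - dl ψ w := by
  simp only [sub_eq_add_neg, dl_add, dl_neg]

lemma dl_sum {ι : Type*} (s : Finset ι) (φ : ι → W p → ZMod p) (w : W p) :
    dl (fun u => ∑ i ∈ s, φ i u) w = ∑ i ∈ s, dl (φ i) w := by
  classical
  induction s using Finset.induction_on with
  | empty => simp [dl_zero]
  | insert a s ha ih => simp only [Finset.sum_insert ha, dl_add, ih]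

lemma dl_dl (φ : W p → ZMod p) (w : W p) : dl (dl φ) w = 0 := by
  induction w generalizing φ with
  | nil => rfl
  | cons x w ih =>
    simp only [dl, dl_sub]
    have := ih (fun u => φ (x :: u))
    simp [this]

lemma dl_sh (φ : W p → ZMod p) (t : ZMod p) (w : W p) :
    dl (fun u => φ (sh t u)) w = dl φ (sh t w) := by
  induction w generalizing φ with
  | nil => rfl
  | cons x w ih =>
    simp only [dl, sh_cons]
    rw [ih (fun u => φ ((x.1 + t, x.2) :: u))]

lemma dl_congr (φ ψ : W p → ZMod p) (w : W p)
    (h : ∀ v, v.Sublist w → φ v = ψ v) : dl φ w = dl ψ w := by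
  induction w generalizing φ ψ with
  | nil => rfl
  | cons x w ih =>
    simp only [dl]
    rw [h w (List.sublist_cons_self x w), ih _ _ (fun v hv => h _ (hv.cons_cons x))]

/-- Valid words: distinct coordinates, all `< n`. -/
def Valid (n : ℕ) (u : W p) : Prop := (u.map Prod.snd).Nodup ∧ ∀ x ∈ u, x.2 < n

lemma Valid.sublist {n : ℕ} {u v : W p} (h : Valid n u) (hv : v.Sublist u) : Valid n v :=
  ⟨h.1.sublist (hv.map _), fun x hx => h.2 x (hv.subset hx)⟩

lemma sh_snd (t : ZMod p) (u : W p) : (sh t u).map Prod.snd = u.map Prod.snd := by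
  simp [sh, Function.comp_def]

lemma Valid.sh {n : ℕ} {u : W p} (h : Valid n u) (t : ZMod p) : Valid n (sh t u) := by
  refine ⟨by rw [sh_snd]; exact h.1, ?_⟩
  intro x hx
  simp only [ZpT.sh, List.mem_map] at hx
  obtain ⟨y, hy, rfl⟩ := hx
  exact h.2 y hy

variable [NeZero p]

lemma op_congr (k : ℕ) (φ ψ : W p → ZMod p) (w : W p)
    (h : ∀ t, φ (sh t w) = ψ (sh t w)) : op k φ w = op k ψ w := by
  have h0 := h 0
  rw [sh_zero] at h0
  simp only [op, h, h0]

lemma op_sub (k : ℕ) (φ ψ : W p → ZMod p) (w : W p) :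
    op k (fun u => φ u - ψ u) w = op k φ w - op k ψ w := by
  unfold op
  split_ifs
  · simp
  · ring

lemma op_zero (k : ℕ) (w : W p) : op k (fun _ => (0 : ZMod p)) w = 0 := by
  simp [op]

lemma dl_op (k : ℕ) (φ : W p → ZMod p) (w : W p) :
    dl (op k φ) w = op k (dl φ) w := by
  by_cases hk : Even k
  · have : op k φ = fun w => ∑ t : ZMod p, φ (sh t w) := by
      funext w; simp [op, hk]
    rw [this, dl_sum]
    simp [op, hk, dl_sh]
  · have : op k φ = fun w => φ (sh 1 w) - φ w := by
      funext w; simp [op, hk]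
    rw [this, dl_sub]
    simp [op, hk, dl_sh]

lemma op_op (k : ℕ) (φ : W p → ZMod p) (w : W p) : op k (op (k + 1) φ) w = 0 := by
  by_cases hk : Even k
  · have hk' : ¬ Even (k + 1) := by simpa [Nat.even_add_one] using hk
    simp only [op, hk, hk', if_true, if_false, sh_sh, Finset.sum_sub_distrib]
    rw [sub_eq_zero]
    exact Equiv.sum_comp (Equiv.addRight (1 : ZMod p)) (fun t => φ (sh t w))
  · have hk' : Even (k + 1) := by simpa [Nat.even_add_one] using hk
    simp only [op, hk, hk', if_true, if_false, sh_sh]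
    rw [sub_eq_zero]
    exact Equiv.sum_comp (Equiv.addLeft (1 : ZMod p)) (fun t => φ (sh t w))

lemma hh_sub (k : ℕ) (φ ψ : W p → ZMod p) :
    hh k (fun u => φ u - ψ u) = hh k φ - hh k ψ := by
  induction k generalizing φ ψ with
  | zero => rfl
  | succ k ih =>
    simp only [hh]
    rw [← ih]
    congr 1
    funext w
    exact op_sub (k + 1) (fun w => φ ((0, k + 1) :: w)) (fun w => ψ ((0, k + 1) :: w)) w

lemma hh_zero (k : ℕ) : hh k (fun _ : W p => (0 : ZMod p)) = 0 := by
  induction k with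
  | zero => rfl
  | succ k ih =>
    simp only [hh]
    rw [show op (k + 1) (fun _ : W p => (0 : ZMod p)) = fun _ => 0 from funext (op_zero _)]
    exact ih

lemma hh_dl (k : ℕ) (ψ : W p → ZMod p) : hh (k + 1) (dl ψ) = hh k (op (k + 1) ψ) := by
  induction k generalizing ψ with
  | zero =>
    simp [hh, op, dl, sh]
  | succ k ih =>
    rw [hh]
    have h1 : op (k + 1 + 1) (fun w => dl ψ ((0, k + 1 + 1) :: w)) =
        fun w => op (k + 1 + 1) ψ w -
          dl (op (k + 1 + 1) (fun u => ψ ((0, k + 1 + 1) :: u))) w := by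
      funext w
      rw [dl_op]
      exact op_sub _ ψ (dl (fun u => ψ ((0, k + 1 + 1) :: u))) w
    rw [h1, hh_sub]
    have h2 := ih (op (k + 1 + 1) (fun u => ψ ((0, k + 1 + 1) :: u)))
    have h3 := hh_zero (p := p) k
    rw [show op (k + 1) (op (k + 1 + 1) (fun u => ψ ((0, k + 1 + 1) :: u))) = fun _ => 0 from
      funext (op_op _ _), h3] at h2
    have h4 := h2
    rw [show hh (k+1) (fun w => dl (op (k + 1 + 1) (fun u => ψ ((0, k + 1 + 1) :: u))) w) = 0
      from h4]
    simp

lemma hh_congr (k : ℕ) (φ ψ : W p → ZMod p) (h : ∀ u, Valid (k + 1) u → φ u = ψ u) :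
    hh k φ = hh k ψ := by
  induction k generalizing φ ψ with
  | zero =>
    exact h _ ⟨by simp, by simp⟩
  | succ k ih =>
    simp only [hh]
    apply ih
    intro u hu
    apply op_congr
    intro t
    apply h
    have hu' := hu.sh t
    refine ⟨?_, ?_⟩
    · simp only [List.map_cons, List.nodup_cons]
      refine ⟨?_, hu'.1⟩
      intro hm
      obtain ⟨x, hx, hx2⟩ := List.mem_map.1 hm
      have := hu'.2 x hx
      omega
    · intro x hx
      rcases List.mem_cons.1 hx with rfl | hx
      · simp
      · have := hu'.2 x hx
        omega

end basic

section FsSec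
variable {p : ℕ} (Λ : W p → ZMod p × ℕ)

lemma Fs_sub (k : ℕ) (φ ψ : W p → ZMod p) (u : W p) :
    Fs Λ k (fun w => φ w - ψ w) u = Fs Λ k φ u - Fs Λ k ψ u := by
  induction k generalizing φ ψ u with
  | zero => simp only [Fs]; split_ifs <;> simp
  | succ k ih =>
    simp only [Fs]
    rw [← dl_sub]
    congr 1
    funext v
    exact ih _ _ _

lemma Fs_zero (k : ℕ) (u : W p) : Fs Λ k (fun _ => (0 : ZMod p)) u = 0 := by
  have := Fs_sub Λ k (fun _ => 0) (fun _ => 0) u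
  simpa using this

lemma Fs_add (k : ℕ) (φ ψ : W p → ZMod p) (u : W p) :
    Fs Λ k (fun w => φ w + ψ w) u = Fs Λ k φ u + Fs Λ k ψ u := by
  have := Fs_sub Λ k (fun w => φ w + ψ w) ψ u
  simp only [add_sub_cancel_right] at this
  rw [this]; ring

lemma Fs_sum {ι : Type*} (s : Finset ι) (k : ℕ) (φ : ι → W p → ZMod p) (u : W p) :
    Fs Λ k (fun w => ∑ i ∈ s, φ i w) u = ∑ i ∈ s, Fs Λ k (φ i) u := by
  classical
  induction s using Finset.induction_on with
  | empty => simp [Fs_zero]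
  | insert a s ha ih => simp only [Finset.sum_insert ha, Fs_add, ih]

lemma Fs_dl (k : ℕ) (φ : W p → ZMod p) (u : W p) :
    Fs Λ (k + 1) (dl φ) u = dl (Fs Λ k φ) u := by
  induction k generalizing φ u with
  | zero =>
    rw [Fs]
    have : Fs Λ 0 (fun w => dl φ (Λ u :: w)) = Fs Λ 0 φ := by
      funext v
      simp [Fs, dl]
    rw [this]
  | succ k ih =>
    rw [Fs]
    have : Fs Λ (k + 1) (fun w => dl φ (Λ u :: w)) = fun v =>
        Fs Λ (k + 1) φ v - dl (Fs Λ k (fun w => φ (Λ u :: w))) v := by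
      funext v
      rw [← ih]
      exact Fs_sub Λ (k + 1) φ (dl (fun w => φ (Λ u :: w))) v
    rw [this, dl_sub, dl_dl, sub_zero]

/-- Compatible words. -/
def Compat (w : W p) : Prop := ∀ x ∈ w, ∀ y ∈ w, x.2 = y.2 → x.1 = y.1

lemma Compat.sublist {u v : W p} (h : Compat u) (hv : v.Sublist u) : Compat v :=
  fun x hx y hy => h x (hv.subset hx) y (hv.subset hy)

lemma Compat.sh {u : W p} (h : Compat u) (t : ZMod p) : Compat (sh t u) := by
  intro x hx y hy hxy
  simp only [ZpT.sh, List.mem_map] at hx hy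
  obtain ⟨x, hx, rfl⟩ := hx
  obtain ⟨y, hy, rfl⟩ := hy
  simp only at hxy ⊢
  rw [h x hx y hy hxy]

lemma Fs_congr {n : ℕ}
    (hc : ∀ u, Valid n u → ∀ v : W p, v.Sublist u → v ≠ [] →
      (Λ v).2 = (Λ u).2 → (Λ v).1 = (Λ u).1)
    (k : ℕ) (φ ψ : W p → ZMod p) (u : W p) (hu : Valid n u)
    (h : ∀ w, w.length = k → Compat w →
      (∀ x ∈ w, ∃ v, v.Sublist u ∧ v ≠ [] ∧ x = Λ v) → φ w = ψ w) :
    Fs Λ k φ u = Fs Λ k ψ u := by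
  induction k generalizing φ ψ u with
  | zero =>
    simp only [Fs]
    rw [h [] rfl (by simp [Compat]) (by simp)]
  | succ k ih =>
    simp only [Fs]
    rcases eq_or_ne u [] with rfl | hne
    · rfl
    apply dl_congr
    intro u' hu'
    apply ih _ _ u' (hu.sublist hu')
    intro w hw hcw hx
    apply h
    · simp [hw]
    · intro x hx' y hy' hxy
      rcases List.mem_cons.1 hx' with rfl | hx1
      · rcases List.mem_cons.1 hy' with rfl | hy1
        · rfl
        · obtain ⟨v, hv, hv0, rfl⟩ := hx y hy1
          exact (hc u hu v (hv.trans hu') hv0 hxy.symm).symm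
      · rcases List.mem_cons.1 hy' with rfl | hy1
        · obtain ⟨v, hv, hv0, rfl⟩ := hx x hx1
          exact hc u hu v (hv.trans hu') hv0 hxy
        · exact hcw x hx1 y hy1 hxy
    · intro x hx'
      rcases List.mem_cons.1 hx' with rfl | hx1
      · exact ⟨u, List.Sublist.refl u, hne, rfl⟩
      · obtain ⟨v, hv, hv0, rfl⟩ := hx x hx1
        exact ⟨v, hv.trans hu', hv0, rfl⟩

lemma Fs_sh {n : ℕ}
    (he : ∀ u, Valid n u → u ≠ [] → ∀ t : ZMod p,
      Λ (sh t u) = ((Λ u).1 + t, (Λ u).2))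
    (k : ℕ) (φ : W p → ZMod p) (t : ZMod p) (u : W p) (hu : Valid n u) :
    Fs Λ k (fun w => φ (sh t w)) u = Fs Λ k φ (sh t u) := by
  induction k generalizing φ u with
  | zero =>
    simp [Fs, sh]
  | succ k ih =>
    rcases eq_or_ne u [] with rfl | hne
    · rfl
    simp only [Fs]
    rw [← dl_sh]
    apply dl_congr
    intro v hv
    rw [he u hu hne]
    rw [← ih _ v (hu.sublist hv)]
    rfl

lemma Fs_op [NeZero p] {n : ℕ}
    (he : ∀ u, Valid n u → u ≠ [] → ∀ t : ZMod p,
      Λ (sh t u) = ((Λ u).1 + t, (Λ u).2))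
    (k j : ℕ) (φ : W p → ZMod p) (u : W p) (hu : Valid n u) :
    Fs Λ k (op j φ) u = op j (Fs Λ k φ) u := by
  by_cases hj : Even j
  · have : op j φ = fun w => ∑ t : ZMod p, φ (sh t w) := by
      funext w; simp [op, hj]
    rw [this, Fs_sum]
    simp only [op, hj, if_true]
    exact Finset.sum_congr rfl (fun t _ => Fs_sh Λ he k φ t u hu)
  · have : op j φ = fun w => φ (sh 1 w) - φ w := by
      funext w; simp [op, hj]
    rw [this, Fs_sub]
    simp only [op, hj, if_false]
    rw [Fs_sh Λ he k φ 1 u hu]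

end FsSec

section alt
variable {p : ℕ}

def Alt (φ : W p → ZMod p) : Prop :=
  (∀ u x y v, φ (u ++ x :: y :: v) = - φ (u ++ y :: x :: v)) ∧
    ∀ u x v, φ (u ++ x :: x :: v) = 0

lemma Alt.cons {φ : W p → ZMod p} (h : Alt φ) (z : ZMod p × ℕ) :
    Alt (fun w => φ (z :: w)) :=
  ⟨fun u x y v => h.1 (z :: u) x y v, fun u x v => h.2 (z :: u) x v⟩

lemma Alt.dl {φ : W p → ZMod p} (h : Alt φ) : Alt (dl φ) := by
  constructor
  · intro u x y v
    induction u generalizing φ with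
    | nil =>
      simp only [List.nil_append, ZpT.dl]
      have : (fun u => φ (x :: y :: u)) = fun u => - φ (y :: x :: u) :=
        funext fun u => h.1 [] x y u
      rw [this, dl_neg]
      ring
    | cons z u ih =>
      simp only [List.cons_append, ZpT.dl]
      rw [ih (h.cons z), h.1]
      ring
  · intro u x v
    induction u generalizing φ with
    | nil =>
      simp only [List.nil_append, ZpT.dl]
      have : (fun u => φ (x :: x :: u)) = fun u => 0 :=
        funext fun u => h.2 [] x u
      rw [this, dl_zero]
      ring
    | cons z u ih =>
      simp only [List.cons_append, ZpT.dl]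
      rw [ih (h.cons z), h.2]
      ring

lemma Alt.perm {φ : W p → ZMod p} (h : Alt φ) {w w' : W p} (hw : w.Perm w') :
    φ w = φ w' ∨ φ w = - φ w' := by
  induction hw generalizing φ with
  | nil => simp
  | cons x _ ih => exact ih (h.cons x)
  | swap x y l => exact Or.inr (h.1 [] y x l)
  | trans _ _ ih1 ih2 =>
    rcases ih1 h with h1 | h1 <;> rcases ih2 h with h2 | h2 <;> simp [h1, h2]

lemma Alt.not_nodup {φ : W p → ZMod p} (h : Alt φ) {w : W p} (hw : ¬ w.Nodup) : φ w = 0 := by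
  rw [← List.exists_duplicate_iff_not_nodup] at hw
  obtain ⟨x, hx⟩ := hw
  rw [List.duplicate_iff_sublist] at hx
  obtain ⟨l, hl⟩ := hx.exists_perm_append
  have h2 := h.2 [] x l
  simp only [List.nil_append] at h2
  rcases h.perm hl with h1 | h1
  · rw [h1]; exact h2
  · rw [h1, neg_eq_zero]; exact h2

open Classical in
/-- Sign of the letter with the smallest label. -/
noncomputable def fsgn (s : Set (ZMod p × ℕ)) : ZMod p :=
  if h : ∃ j g, (g, j) ∈ s then (Nat.find_spec h).choose else 0

lemma fsgn_spec (s : Set (ZMod p × ℕ)) (hs : s.Nonempty) :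
    ∃ j, (fsgn s, j) ∈ s ∧ ∀ x ∈ s, j ≤ x.2 := by
  classical
  have h : ∃ j g, (g, j) ∈ s := ⟨hs.some.2, hs.some.1, hs.some_mem⟩
  refine ⟨Nat.find h, ?_, ?_⟩
  · unfold fsgn
    rw [dif_pos h]
    exact (Nat.find_spec h).choose_spec
  · intro x hx
    exact Nat.find_min' h ⟨x.1, hx⟩

noncomputable def asg (w : W p) : ZMod p := fsgn {x | x ∈ w}

lemma asg_spec (w : W p) (hw : w ≠ []) : ∃ j, (asg w, j) ∈ w ∧ ∀ x ∈ w, j ≤ x.2 := by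
  obtain ⟨x, hx⟩ := List.exists_mem_of_ne_nil w hw
  exact fsgn_spec {x | x ∈ w} ⟨x, hx⟩

lemma asg_unique (w : W p) (hc : Compat w) (g : ZMod p) (j : ℕ) (h : (g, j) ∈ w)
    (h' : ∀ x ∈ w, j ≤ x.2) : asg w = g := by
  obtain ⟨j', h1, h2⟩ := asg_spec w (List.ne_nil_of_mem h)
  have e : j' = j := le_antisymm (h2 _ h) (h' _ h1)
  exact hc _ h1 _ h e

lemma asg_sh (w : W p) (hc : Compat w) (hw : w ≠ []) (t : ZMod p) :
    asg (sh t w) = asg w + t := by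
  obtain ⟨j, h1, h2⟩ := asg_spec w hw
  apply asg_unique _ (hc.sh t) _ j
  · exact List.mem_map.2 ⟨_, h1, rfl⟩
  · intro x hx
    obtain ⟨y, hy, rfl⟩ := List.mem_map.1 hx
    exact h2 y hy

lemma asg_swap (u v : W p) (x y : ZMod p × ℕ) :
    asg (u ++ x :: y :: v) = asg (u ++ y :: x :: v) := by
  unfold asg
  congr 1
  ext z
  simp only [List.mem_append, List.mem_cons, Set.mem_ofPred_eq]
  tauto

lemma Alt.sh {φ : W p → ZMod p} (h : Alt φ) (t : ZMod p) : Alt (fun w => φ (sh t w)) := by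
  constructor
  · intro u x y v
    simp only [ZpT.sh, List.map_append, List.map_cons]
    exact h.1 _ _ _ _
  · intro u x v
    simp only [ZpT.sh, List.map_append, List.map_cons]
    exact h.2 _ _ _

lemma exists_theta [NeZero p] (k : ℕ) (φ : W p → ZMod p) (hA : Alt φ) (h0 : φ [] = 0)
    (hop : ∀ w, Compat w → op k φ w = 0) :
    ∃ θ : W p → ZMod p, Alt θ ∧ ∀ w, Compat w → op (k + 1) θ w = φ w := by
  by_cases hk : Even k
  · have hk' : ¬ Even (k + 1) := by simpa [Nat.even_add_one] using hk
    refine ⟨fun w => ∑ i ∈ Finset.range (asg w).val, φ (sh ((i : ZMod p) - asg w) w),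
      ⟨?_, ?_⟩, ?_⟩
    · intro u x y v
      simp only
      rw [asg_swap, ← Finset.sum_neg_distrib]
      exact Finset.sum_congr rfl fun i _ => (hA.sh _).1 u x y v
    · intro u x v
      exact Finset.sum_eq_zero fun i _ => (hA.sh _).2 u x v
    · intro w hw
      simp only [op, hk', if_false]
      rcases eq_or_ne w [] with rfl | hne
      · simp [sh_nil, h0]
      have hN := hop (sh (- asg w) w) (hw.sh _)
      simp only [op, hk, if_true, sh_sh] at hN
      have hN' : ∑ i ∈ Finset.range p, φ (sh (- asg w + (i : ZMod p)) w) = 0 := by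
        rw [← hN]
        refine Finset.sum_bij' (fun i _ => (i : ZMod p)) (fun t _ => t.val) ?_ ?_ ?_ ?_ ?_
        · simp
        · intro t _; simpa using ZMod.val_lt t
        · intro i hi; simpa using ZMod.val_cast_of_lt (by simpa using hi)
        · intro t _; simp
        · intro i _; rfl
      rw [asg_sh w hw hne]
      have e : ∀ i : ℕ, sh ((i : ZMod p) - (asg w + 1)) (sh 1 w) = sh (- asg w + (i : ZMod p)) w := by
        intro i; rw [sh_sh]; congr 1; ring
      have e' : ∀ i : ℕ, sh ((i : ZMod p) - asg w) w = sh (- asg w + (i : ZMod p)) w := by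
        intro i; congr 1; ring
      simp only [e, e']
      have hlast : φ (sh (- asg w + ((asg w).val : ZMod p)) w) = φ w := by
        simp [sh_zero]
      have hlt := ZMod.val_lt (asg w)
      rcases Nat.lt_or_ge ((asg w).val + 1) p with hl | hl
      · have hv : (asg w + 1).val = (asg w).val + 1 := by
          have : asg w + 1 = (((asg w).val + 1 : ℕ) : ZMod p) := by simp
          rw [this, ZMod.val_cast_of_lt hl]
        rw [hv, Finset.sum_range_succ, hlast]
        ring
      · have hp : p = (asg w).val + 1 := by omega
        have hv : (asg w + 1).val = 0 := by
          have : asg w + 1 = (((asg w).val + 1 : ℕ) : ZMod p) := by simp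
          rw [this, ← hp]; simp
        rw [hv]
        rw [show Finset.range p = Finset.range ((asg w).val + 1) from congrArg _ hp,
          Finset.sum_range_succ, hlast] at hN'
        simp only [Finset.range_zero, Finset.sum_empty]
        linear_combination (-1 : ZMod p) * hN'
  · have hk' : Even (k + 1) := by simpa [Nat.even_add_one] using hk
    refine ⟨fun w => if asg w = 0 then φ w else 0, ⟨?_, ?_⟩, ?_⟩
    · intro u x y v
      simp only
      rw [asg_swap]
      split_ifs
      · exact hA.1 u x y v
      · simp
    · intro u x v
      simp [hA.2 u x v]
    · intro w hw
      simp only [op, hk', if_true]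
      rcases eq_or_ne w [] with rfl | hne
      · simp [sh_nil, h0]
      have hinv : ∀ t : ℕ, ∀ w, Compat w → φ (sh (t : ZMod p) w) = φ w := by
        intro t
        induction t with
        | zero => intro w _; simp [sh_zero]
        | succ t ih =>
          intro w hw
          have h1 := hop (sh (t : ZMod p) w) (hw.sh _)
          simp only [op, hk, if_false, sh_sh] at h1
          rw [sub_eq_zero, ih w hw] at h1
          rw [← h1]; push_cast; rfl
      have hinv' : ∀ t : ZMod p, φ (sh t w) = φ w := by
        intro t
        have := hinv t.val w hw
        simpa using this
      simp only [hinv', asg_sh w hw hne]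
      rw [Finset.sum_eq_single (- asg w)]
      · simp
      · intro b _ hb
        rw [if_neg]
        intro h; apply hb; linear_combination h
      · simp

end alt

theorem tucker (p n m : ℕ) [NeZero p] (hp1 : 1 < p) (Λ : W p → ZMod p × ℕ)
    (he : ∀ u, Valid n u → u ≠ [] → ∀ t : ZMod p,
      Λ (sh t u) = ((Λ u).1 + t, (Λ u).2))
    (hm : ∀ u, Valid n u → u ≠ [] → (Λ u).2 < m)
    (hc : ∀ u, Valid n u → ∀ v : W p, v.Sublist u → v ≠ [] →
      (Λ v).2 = (Λ u).2 → (Λ v).1 = (Λ u).1) : n ≤ m := by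
  by_contra hnm
  push Not at hnm
  have : Fact (1 < p) := ⟨hp1⟩
  have key : ∀ k, k < n → ∃ Φ : W p → ZMod p, Alt Φ ∧ Φ [] = 0 ∧
      (∀ w, Compat w → op k Φ w = 0) ∧ (∀ w, Compat w → dl Φ w = 0) ∧
      hh k (Fs Λ (k + 1) Φ) = 1 := by
    intro k
    induction k with
    | zero =>
      intro _
      refine ⟨fun w => if w.length = 1 then 1 else 0, ⟨?_, ?_⟩, ?_, ?_, ?_, ?_⟩
      · intro u x y v
        have h1 : ∀ a b : ZMod p × ℕ, (u ++ a :: b :: v).length ≠ 1 := by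
          intro a b; simp; omega
        simp only [h1, if_false, neg_zero]
      · intro u x v
        have h1 : ∀ a b : ZMod p × ℕ, (u ++ a :: b :: v).length ≠ 1 := by
          intro a b; simp; omega
        simp only [h1, if_false]
      · simp
      · intro w _
        have : ∀ t : ZMod p, (sh t w).length = w.length := by intro t; simp [sh]
        simp [op, this]
      · intro w _
        match w with
        | [] => rfl
        | [x] => simp [dl]
        | [x, y] => simp [dl]
        | x :: y :: z :: w =>
          have h0 : ∀ a b : ZMod p × ℕ, (fun u : W p => if (a :: b :: u).length = 1 then (1 : ZMod p) else 0)
            = fun _ => 0 := by intro a b; funext u; simp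
          simp only [dl]
          have h1 := dl_zero (p := p) w
          simp [h1]
      · simp [hh, Fs, dl]
    | succ k ih =>
      intro hk
      obtain ⟨Φ, hA, h0, hop, hd, hv⟩ := ih (by omega)
      obtain ⟨θ, hθA, hθ⟩ := exists_theta k Φ hA h0 hop
      refine ⟨dl θ, hθA.dl, rfl, ?_, ?_, ?_⟩
      · intro w hw
        rw [← dl_op, ← hd w hw]
        exact dl_congr _ _ _ fun v hv => hθ v (hw.sublist hv)
      · intro w _
        exact dl_dl θ w
      · rw [show Fs Λ (k + 1 + 1) (dl θ) = dl (Fs Λ (k + 1) θ) from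
          funext (Fs_dl Λ (k + 1) θ), hh_dl, ← hv]
        apply hh_congr
        intro u hu
        have hu' : Valid n u := ⟨hu.1, fun x hx => by have := hu.2 x hx; omega⟩
        rw [← Fs_op Λ he (k + 1) (k + 1) θ u hu']
        apply Fs_congr Λ hc _ _ _ _ hu'
        intro w _ hw _
        exact hθ w hw
  obtain ⟨Φ, hA, h0, hop, hd, hv⟩ := key m hnm
  have : hh m (Fs Λ (m + 1) Φ) = 0 := by
    rw [← hh_zero (p := p) m]
    apply hh_congr
    intro u hu
    have hu' : Valid n u := ⟨hu.1, fun x hx => by have := hu.2 x hx; omega⟩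
    rw [← Fs_zero Λ (m + 1) u]
    apply Fs_congr Λ hc _ _ _ _ hu'
    intro w hl hw hx
    apply hA.not_nodup
    intro hnd
    have hnd2 : (w.map Prod.snd).Nodup := by
      apply List.Nodup.map_on _ hnd
      intro x hx y hy hxy
      exact Prod.ext (hw x hx y hy hxy) hxy
    have hsub : (w.map Prod.snd).toFinset ⊆ Finset.range m := by
      intro j hj
      simp only [List.mem_toFinset, List.mem_map] at hj
      obtain ⟨x, hxw, rfl⟩ := hj
      obtain ⟨v, hv, hv0, rfl⟩ := hx x hxw
      exact Finset.mem_range.2 (hm v (hu'.sublist hv) hv0)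
    have := Finset.card_le_card hsub
    rw [List.toFinset_card_of_nodup hnd2] at this
    simp [hl] at this
  rw [this] at hv
  exact zero_ne_one hv

end ZpT

namespace ZpT

lemma altList_bdd {α : Type*} (n : ℕ) (σ : Equiv.Perm (Fin n)) (X : Fin n → Option α)
    (l : List (Fin n)) (h : IsAltList n σ X l) : l.length ≤ n := by
  have h1 : l.Pairwise (· < ·) := List.isChain_iff_pairwise.1 h.1
  have h2 : l.Nodup := h1.imp (fun h => ne_of_lt h)
  simpa using h2.length_le_card

lemma altSet_bdd {α : Type*} (n : ℕ) (σ : Equiv.Perm (Fin n)) (X : Fin n → Option α) :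
    BddAbove {k | ∃ l : List (Fin n), IsAltList n σ X l ∧ l.length = k} := by
  refine ⟨n, ?_⟩
  rintro k ⟨l, hl, rfl⟩
  exact altList_bdd n σ X l hl

lemma le_altVec {α : Type*} (n : ℕ) (σ : Equiv.Perm (Fin n)) (X : Fin n → Option α)
    (l : List (Fin n)) (h : IsAltList n σ X l) : l.length ≤ altVec n σ X :=
  le_csSup (altSet_bdd n σ X) ⟨l, h, rfl⟩

lemma altVec_mem {α : Type*} (n : ℕ) (σ : Equiv.Perm (Fin n)) (X : Fin n → Option α) :
    ∃ l : List (Fin n), IsAltList n σ X l ∧ l.length = altVec n σ X := by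
  have hne : {k | ∃ l : List (Fin n), IsAltList n σ X l ∧ l.length = k}.Nonempty :=
    ⟨0, [], ⟨List.IsChain.nil, by simp, List.IsChain.nil⟩, rfl⟩
  exact Nat.sSup_mem hne (altSet_bdd n σ X)

lemma altVec_le {α : Type*} (n : ℕ) (σ : Equiv.Perm (Fin n)) (X : Fin n → Option α) :
    altVec n σ X ≤ n := by
  obtain ⟨l, hl, h⟩ := altVec_mem n σ X
  rw [← h]
  exact altList_bdd n σ X l hl

lemma altVec_map {α : Type*} (n : ℕ) (σ : Equiv.Perm (Fin n)) (X : Fin n → Option α)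
    (f : α → α) (hf : Function.Injective f) :
    altVec n σ (fun a => (X a).map f) = altVec n σ X := by
  unfold altVec IsAltList
  have h1 : ∀ a, (X a).map f ≠ none ↔ X a ≠ none := by intro a; simp
  have h2 : ∀ a b, (X a).map f ≠ (X b).map f ↔ X a ≠ X b := by
    intro a b
    exact (Option.map_injective hf).ne_iff
  simp only [h1, h2]

lemma alt_cons {α : Type*} (n : ℕ) (σ : Equiv.Perm (Fin n)) (X : Fin n → Option α)
    (k x : Fin n) (r : List (Fin n)) (h : IsAltList n σ X (x :: r)) (hk : X (σ k) ≠ none)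
    (hle : k ≤ x) (hne : X (σ k) ≠ X (σ x)) : IsAltList n σ X (k :: x :: r) := by
  have hlt : k < x := lt_of_le_of_ne hle (fun h => hne (by rw [h]))
  refine ⟨List.isChain_cons_cons.2 ⟨hlt, h.1⟩, ?_, List.isChain_cons_cons.2 ⟨hne, h.2.2⟩⟩
  intro i hi
  rcases List.mem_cons.1 hi with rfl | hi
  · exact hk
  · exact h.2.1 i hi

lemma alt_first {α : Type*} (n : ℕ) (σ : Equiv.Perm (Fin n)) (X Y : Fin n → Option α)
    (hXY : ∀ a, X a ≠ none → Y a = X a) (halt : altVec n σ X = altVec n σ Y)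
    (k l : Fin n) (hk : X (σ k) ≠ none) (hk' : ∀ j, X (σ j) ≠ none → k ≤ j)
    (hl : Y (σ l) ≠ none) (hl' : ∀ j, Y (σ j) ≠ none → l ≤ j) :
    X (σ k) = Y (σ l) := by
  obtain ⟨L, hL, hlen⟩ := altVec_mem n σ X
  match L, hL, hlen with
  | [], _, hlen =>
    exfalso
    have := le_altVec n σ X [k] ⟨List.isChain_singleton _, by simpa using hk,
      List.isChain_singleton _⟩
    simp at this hlen
    omega
  | x :: r, hL, hlen =>
    have hx : X (σ x) ≠ none := hL.2.1 x (by simp)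
    have e1 : X (σ k) = X (σ x) := by
      by_contra hne
      have := le_altVec n σ X _ (alt_cons n σ X k x r hL hk (hk' x hx) hne)
      simp at this hlen
      omega
    have hLY : IsAltList n σ Y (x :: r) := by
      refine ⟨hL.1, ?_, ?_⟩
      · intro i hi
        rw [hXY _ (hL.2.1 i hi)]
        exact hL.2.1 i hi
      · refine List.IsChain.imp_of_mem_imp ?_ hL.2.2
        intro a b ha hb hab
        rw [hXY _ (hL.2.1 a ha), hXY _ (hL.2.1 b hb)]
        exact hab
    by_contra hne
    have hYx : Y (σ x) = X (σ x) := hXY _ hx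
    have := le_altVec n σ Y _ (alt_cons n σ Y l x r hLY hl (hl' x (by rw [hYx]; exact hx))
      (by rw [hYx, ← e1]; exact fun h => hne h.symm))
    simp at this hlen
    omega

section vec
variable {n p : ℕ} [NeZero p]

lemma Valid.compat {u : W p} (h : Valid n u) : Compat u := by
  intro x hx y hy hxy
  exact congrArg Prod.fst (List.inj_on_of_nodup_map h.1 hx hy hxy)

/-- The identification of `Fin p` with `ZMod p`. -/
def eqv (p : ℕ) [NeZero p] : Fin p ≃ ZMod p := (ZMod.finEquiv p).toEquiv

open Classical in
/-- The vector of a word. -/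
noncomputable def Xv (σ : Equiv.Perm (Fin n)) (u : W p) (a : Fin n) : Option (Fin p) :=
  if h : ∃ j : Fin p, (eqv p j, (σ.symm a).val) ∈ u then some h.choose else none

lemma Xv_iff (σ : Equiv.Perm (Fin n)) (u : W p) (hu : Valid n u) (a : Fin n) (j : Fin p) :
    Xv σ u a = some j ↔ (eqv p j, (σ.symm a).val) ∈ u := by
  unfold Xv
  split_ifs with h
  · have hs := h.choose_spec
    constructor
    · intro e
      rw [Option.some.injEq] at e
      rw [← e]; exact hs
    · intro hj
      rw [Option.some.injEq]
      exact (eqv p).injective (hu.compat _ hs _ hj rfl)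
  · simp only [reduceCtorEq, false_iff]
    exact fun h' => h ⟨j, h'⟩

lemma Xv_ne_none (σ : Equiv.Perm (Fin n)) (u : W p) (a : Fin n) :
    Xv σ u a ≠ none ↔ ∃ g, (g, (σ.symm a).val) ∈ u := by
  unfold Xv
  split_ifs with h
  · simp only [ne_eq, reduceCtorEq, not_false_eq_true, true_iff]
    exact ⟨_, h.choose_spec⟩
  · simp only [ne_eq, not_true_eq_false, false_iff]
    rintro ⟨g, hg⟩
    exact h ⟨(eqv p).symm g, by simpa using hg⟩

lemma mem_sh (t g : ZMod p) (k : ℕ) (u : W p) : (g + t, k) ∈ sh t u ↔ (g, k) ∈ u := by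
  simp [sh]

lemma Xv_sh (σ : Equiv.Perm (Fin n)) (u : W p) (hu : Valid n u) (t : ZMod p) :
    Xv σ (sh t u) = fun a => (Xv σ u a).map (fun j => (eqv p).symm (eqv p j + t)) := by
  funext a
  ext j
  rw [Xv_iff σ _ (hu.sh t)]
  simp only [Option.map_eq_some_iff, Xv_iff σ u hu]
  constructor
  · intro h
    refine ⟨(eqv p).symm (eqv p j - t), ?_, by simp⟩
    rw [← mem_sh t]
    simpa using h
  · rintro ⟨j', h, rfl⟩
    rw [← mem_sh t] at h
    simpa using h

lemma altVec_sh (σ : Equiv.Perm (Fin n)) (u : W p) (hu : Valid n u) (t : ZMod p) :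
    altVec n σ (Xv σ (sh t u)) = altVec n σ (Xv σ u) := by
  rw [Xv_sh σ u hu t]
  apply altVec_map
  intro a b h
  simpa using h

lemma asg_first (σ : Equiv.Perm (Fin n)) (u : W p) (hu : Valid n u) (hne : u ≠ []) :
    ∃ k : Fin n, Xv σ u (σ k) = some ((eqv p).symm (asg u)) ∧
      ∀ j, Xv σ u (σ j) ≠ none → k ≤ j := by
  obtain ⟨j, h1, h2⟩ := asg_spec u hne
  refine ⟨⟨j, hu.2 _ h1⟩, ?_, ?_⟩
  · rw [Xv_iff σ u hu]
    simpa using h1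
  · intro j' hj'
    obtain ⟨g, hg⟩ := (Xv_ne_none σ u _).1 hj'
    have := h2 _ hg
    simpa [Fin.le_def] using this

lemma asg_eq (σ : Equiv.Perm (Fin n)) (u v : W p) (hu : Valid n u) (hv : v.Sublist u)
    (hv0 : v ≠ []) (h : altVec n σ (Xv σ v) = altVec n σ (Xv σ u)) : asg v = asg u := by
  have hu0 : u ≠ [] := by
    rintro rfl
    exact hv0 (List.sublist_nil.1 hv)
  obtain ⟨k, h1, h2⟩ := asg_first σ v (hu.sublist hv) hv0
  obtain ⟨l, h3, h4⟩ := asg_first σ u hu hu0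
  have := alt_first n σ (Xv σ v) (Xv σ u) (by
    intro a ha
    obtain ⟨j, hj⟩ := Option.ne_none_iff_exists'.1 ha
    rw [hj, Xv_iff σ u hu]
    exact hv.subset ((Xv_iff σ v (hu.sublist hv) a j).1 hj)) h k l (by simp [h1]) h2
    (by simp [h3]) h4
  rw [h1, h3] at this
  simpa using this

lemma altVec_pos (σ : Equiv.Perm (Fin n)) (u : W p) (hu : Valid n u) (hne : u ≠ []) :
    1 ≤ altVec n σ (Xv σ u) := by
  obtain ⟨k, h1, _⟩ := asg_first σ u hu hne
  have := le_altVec n σ (Xv σ u) [k] ⟨List.isChain_singleton _, by simp [h1],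
      List.isChain_singleton _⟩
  simpa using this

def sub (σ : Equiv.Perm (Fin n)) (u : W p) (g : ZMod p) (A : Finset (Fin n)) : Prop :=
  ∀ b ∈ A, (g, (σ.symm b).val) ∈ u

lemma sub_sh (σ : Equiv.Perm (Fin n)) (u : W p) (t g : ZMod p) (A : Finset (Fin n)) :
    sub σ (sh t u) (g + t) A ↔ sub σ u g A := by
  simp only [sub, mem_sh]

open Classical in
noncomputable def SS (σ : Equiv.Perm (Fin n)) (F : Finset (Finset (Fin n)))
    (c : Finset (Fin n) → ℕ) (u : W p) (a : ℕ) : Finset (ZMod p) :=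
  Finset.univ.filter (fun g => ∃ A ∈ F, c A = a ∧ sub σ u g A)

open Classical in
noncomputable def mc (σ : Equiv.Perm (Fin n)) (F : Finset (Finset (Fin n)))
    (c : Finset (Fin n) → ℕ) (u : W p) : ℕ :=
  (F.filter (fun A => ∃ g, sub σ u g A)).sup c

lemma mc_sh (σ : Equiv.Perm (Fin n)) (F : Finset (Finset (Fin n)))
    (c : Finset (Fin n) → ℕ) (u : W p) (t : ZMod p) : mc σ F c (sh t u) = mc σ F c u := by
  classical
  unfold mc
  congr 1
  apply Finset.filter_congr
  intro A _
  constructor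
  · rintro ⟨g, hg⟩
    refine ⟨g - t, ?_⟩
    rw [← sub_sh σ u t]
    simpa using hg
  · rintro ⟨g, hg⟩
    exact ⟨g + t, (sub_sh σ u t g A).2 hg⟩

lemma SS_sh (σ : Equiv.Perm (Fin n)) (F : Finset (Finset (Fin n)))
    (c : Finset (Fin n) → ℕ) (u : W p) (t : ZMod p) (a : ℕ) :
    SS σ F c (sh t u) a = (SS σ F c u a).map (Equiv.addRight t).toEmbedding := by
  classical
  ext g
  simp only [SS, Finset.mem_filter, Finset.mem_univ, true_and, Finset.mem_map,
    Equiv.coe_toEmbedding, Equiv.coe_addRight]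
  constructor
  · rintro ⟨A, hA, hc, hs⟩
    refine ⟨g - t, ⟨A, hA, hc, ?_⟩, by simp⟩
    rw [← sub_sh σ u t]
    simpa using hs
  · rintro ⟨g', ⟨A, hA, hc, hs⟩, rfl⟩
    exact ⟨A, hA, hc, (sub_sh σ u t g' A).2 hs⟩

lemma SS_mono (σ : Equiv.Perm (Fin n)) (F : Finset (Finset (Fin n)))
    (c : Finset (Fin n) → ℕ) (u v : W p) (h : v.Sublist u) (a : ℕ) :
    SS σ F c v a ⊆ SS σ F c u a := by
  classical
  intro g
  simp only [SS, Finset.mem_filter, Finset.mem_univ, true_and]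
  rintro ⟨A, hA, hc, hs⟩
  exact ⟨A, hA, hc, fun b hb => h.subset (hs b hb)⟩

/-- Sets are nonempty and disjoint, so a color class does not meet all signs. -/
lemma SS_card_lt (σ : Equiv.Perm (Fin n)) (F : Finset (Finset (Fin n)))
    (hF : ∀ A ∈ F, A.Nonempty) (t : ℕ)
    (c : Finset (Fin n) → ℕ) (hcol : IsKneserColoring n p t F c) (u : W p) (hu : Valid n u)
    (a : ℕ) : (SS σ F c u a).card < p := by
  classical
  have hle : (SS σ F c u a).card ≤ p := by
    have := Finset.card_le_univ (SS σ F c u a)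
    rwa [ZMod.card] at this
  refine lt_of_le_of_ne hle ?_
  intro heq
  have huniv : SS σ F c u a = Finset.univ := by
    rw [← Finset.card_eq_iff_eq_univ, heq, ZMod.card]
  have hall : ∀ g : ZMod p, ∃ A ∈ F, c A = a ∧ sub σ u g A := by
    intro g
    have hg : g ∈ SS σ F c u a := by rw [huniv]; exact Finset.mem_univ g
    simpa [SS] using hg
  choose A hAF hAc hAs using hall
  have hdis : ∀ g g', g ≠ g' → Disjoint (A g) (A g') := by
    intro g g' hne
    rw [Finset.disjoint_left]
    intro b hb hb'
    exact hne (hu.compat _ (hAs g b hb) _ (hAs g' b hb') rfl)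
  have hinj : Function.Injective A := by
    intro g g' h
    by_contra hne
    have h1 := hdis g g' hne
    rw [h, disjoint_self] at h1
    have := hF _ (hAF g')
    rw [h1] at this
    simp at this
  refine hcol.2 (Finset.univ.image A) ?_ ?_ ?_ ⟨a, ?_⟩
  · intro B hB
    simp only [Finset.mem_image, Finset.mem_univ, true_and] at hB
    obtain ⟨g, rfl⟩ := hB
    exact hAF g
  · rw [Finset.card_image_of_injective _ hinj, Finset.card_univ, ZMod.card]
  · intro B hB B' hB' hne
    simp only [Finset.coe_image, Finset.coe_univ, Set.image_univ, Set.mem_range] at hB hB'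
    obtain ⟨g, rfl⟩ := hB
    obtain ⟨g', rfl⟩ := hB'
    exact hdis g g' (fun h => hne (by rw [h]))
  · intro B hB
    simp only [Finset.mem_image, Finset.mem_univ, true_and] at hB
    obtain ⟨g, rfl⟩ := hB
    exact hAc g

lemma mc_ge (σ : Equiv.Perm (Fin n)) (F : Finset (Finset (Fin n))) (i t : ℕ) (hi : 1 ≤ i)
    (c : Finset (Fin n) → ℕ) (hcol : IsKneserColoring n p t F c) (u : W p) (hu : Valid n u)
    (hne : u ≠ []) (halt : altHypI n p σ F i < altVec n σ (Xv σ u)) :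
    i ≤ mc σ F c u ∧ mc σ F c u ≤ t ∧ (SS σ F c u (mc σ F c u)).Nonempty := by
  classical
  set G := F.filter (fun A => ∃ g, sub σ u g A) with hG
  have hGe : (F.filter fun A => ∃ j : Fin p, ∀ a ∈ A, Xv σ u a = some j) = G := by
    apply Finset.filter_congr
    intro A _
    constructor
    · rintro ⟨j, hj⟩
      exact ⟨eqv p j, fun b hb => (Xv_iff σ u hu b j).1 (hj b hb)⟩
    · rintro ⟨g, hg⟩
      refine ⟨(eqv p).symm g, fun b hb => (Xv_iff σ u hu b _).2 ?_⟩
      simpa using hg b hb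
  have hnot : ¬ kneserChrom n p G ≤ i - 1 := by
    intro hle
    apply absurd halt
    rw [not_lt]
    unfold altHypI
    apply le_csSup
    · refine ⟨n, ?_⟩
      rintro k ⟨X, _, rfl, _⟩
      exact altVec_le n σ X
    · refine ⟨Xv σ u, ?_, rfl, ?_⟩
      · obtain ⟨k, h1, _⟩ := asg_first σ u hu hne
        exact ⟨σ k, by simp [h1]⟩
      · rw [← hGe] at hle
        convert hle
  have hex : ∃ A ∈ G, i ≤ c A := by
    by_contra hcon
    push Not at hcon
    apply hnot
    apply Nat.sInf_le
    refine ⟨c, ?_, ?_⟩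
    · intro A hA
      have h1 := hcol.1 A (Finset.mem_filter.1 hA).1
      have h2 := hcon A hA
      simp only [Finset.mem_Icc] at h1 ⊢
      omega
    · intro E hE
      exact hcol.2 E (hE.trans (Finset.filter_subset _ _))
  obtain ⟨A, hA, hiA⟩ := hex
  have hmc : mc σ F c u = G.sup c := rfl
  obtain ⟨B, hB, hBe⟩ := Finset.exists_mem_eq_sup G ⟨A, hA⟩ c
  refine ⟨?_, ?_, ?_⟩
  · rw [hmc]
    exact hiA.trans (Finset.le_sup (f := c) hA)
  · rw [hmc, hBe]
    have h1 := hcol.1 B (Finset.mem_filter.1 hB).1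
    simp only [Finset.mem_Icc] at h1
    exact h1.2
  · obtain ⟨hBF, g, hg⟩ := Finset.mem_filter.1 hB
    refine ⟨g, ?_⟩
    simp only [SS, Finset.mem_filter, Finset.mem_univ, true_and]
    exact ⟨B, hBF, by rw [hmc, hBe], hg⟩

end vec

theorem main_bound (n p : ℕ) (hp : p.Prime) (F : Finset (Finset (Fin n)))
    (hF : ∀ A ∈ F, A.Nonempty) (i : ℕ) (hi : 1 ≤ i) (t : ℕ) (hit : i ≤ t + 1)
    (c : Finset (Fin n) → ℕ) (hcol : IsKneserColoring n p t F c) (σ : Equiv.Perm (Fin n)) :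
    n ≤ altHypI n p σ F i + (t + 1 - i) * (p - 1) := by
  classical
  have : Fact p.Prime := ⟨hp⟩
  have hp2 := hp.two_le
  have : NeZero p := ⟨hp.ne_zero⟩
  set α := altHypI n p σ F i with hα
  set S : W p → Finset (ZMod p) := fun u => SS σ F c u (mc σ F c u) with hS
  let Λ : W p → ZMod p × ℕ := fun u =>
    if altVec n σ (Xv σ u) ≤ α then (asg u, altVec n σ (Xv σ u) - 1)
    else ((∑ g ∈ S u, g) / ((S u).card : ZMod p),
      α + (mc σ F c u - i) * (p - 1) + ((S u).card - 1))
  have big : ∀ u, Valid n u → u ≠ [] → ¬ altVec n σ (Xv σ u) ≤ α →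
      i ≤ mc σ F c u ∧ mc σ F c u ≤ t ∧ 1 ≤ (S u).card ∧ (S u).card < p := by
    intro u hu hne h
    obtain ⟨h1, h2, h3⟩ := mc_ge σ F i t hi c hcol u hu hne (not_le.1 h)
    exact ⟨h1, h2, Finset.card_pos.2 h3, SS_card_lt σ F hF t c hcol u hu _⟩
  apply tucker p n _ (by omega) Λ
  · intro u hu hne s
    simp only [Λ, altVec_sh σ u hu s]
    split_ifs with h
    · rw [asg_sh u hu.compat hne]
    · obtain ⟨h1, h2, h3, h4⟩ := big u hu hne h
      have hSs : S (sh s u) = (S u).map (Equiv.addRight s).toEmbedding := by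
        simp only [hS, mc_sh, SS_sh]
      have hcard0 : ((S u).card : ZMod p) ≠ 0 := by
        intro h0
        rw [ZMod.natCast_eq_zero_iff] at h0
        exact absurd (Nat.le_of_dvd h3 h0) (by omega)
      rw [hSs, mc_sh]
      simp only [Finset.card_map, Finset.sum_map, Equiv.coe_toEmbedding, Equiv.coe_addRight,
        Finset.sum_add_distrib, Finset.sum_const, nsmul_eq_mul, Prod.mk.injEq, and_true]
      field_simp
  · intro u hu hne
    simp only [Λ]
    split_ifs with h
    · have := altVec_pos σ u hu hne
      simp only
      omega
    · obtain ⟨h1, h2, h3, h4⟩ := big u hu hne h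
      simp only
      have e : (t + 1 - i) * (p - 1) = (t - i) * (p - 1) + (p - 1) := by
        rw [show t + 1 - i = (t - i) + 1 by omega]; ring
      have e2 : (mc σ F c u - i) * (p - 1) ≤ (t - i) * (p - 1) :=
        Nat.mul_le_mul_right _ (by omega)
      omega
  · intro u hu v hv hv0
    have hu0 : u ≠ [] := by
      rintro rfl
      exact hv0 (List.sublist_nil.1 hv)
    have hv' := hu.sublist hv
    have pu := altVec_pos σ u hu hu0
    have pv := altVec_pos σ v hv' hv0
    simp only [Λ]
    by_cases hau : altVec n σ (Xv σ u) ≤ α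
    · by_cases hav : altVec n σ (Xv σ v) ≤ α
      · simp only [hau, hav, if_true]
        intro h
        exact asg_eq σ u v hu hv hv0 (by omega)
      · simp only [hau, hav, if_true, if_false]
        intro h
        exfalso
        have := Nat.zero_le ((mc σ F c v - i) * (p - 1))
        omega
    · by_cases hav : altVec n σ (Xv σ v) ≤ α
      · simp only [hau, hav, if_true, if_false]
        intro h
        exfalso
        have := Nat.zero_le ((mc σ F c u - i) * (p - 1))
        omega
      · simp only [hau, hav, if_false]
        intro h
        obtain ⟨h1, h2, h3, h4⟩ := big u hu hu0 hau
        obtain ⟨k1, k2, k3, k4⟩ := big v hv' hv0 hav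
        have hq : mc σ F c v - i = mc σ F c u - i := by
          have hh : (p - 1) * (mc σ F c v - i) + ((S v).card - 1) =
            (p - 1) * (mc σ F c u - i) + ((S u).card - 1) := by
            rw [mul_comm (p - 1), mul_comm (p - 1)]; omega
          have := congrArg (· / (p - 1)) hh
          simp only [Nat.mul_add_div (show 0 < p - 1 by omega)] at this
          rw [Nat.div_eq_of_lt (show (S v).card - 1 < p - 1 by omega),
            Nat.div_eq_of_lt (show (S u).card - 1 < p - 1 by omega)] at this
          simpa using this
        have hmc : mc σ F c v = mc σ F c u := by omega
        have hcard : (S v).card = (S u).card := by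
          rw [hq] at h
          omega
        have hsub : S v ⊆ S u := by
          simp only [hS, hmc]
          exact SS_mono σ F c u v hv _
        rw [Finset.eq_of_subset_of_card_le hsub hcard.ge]

lemma exists_coloring (n p : ℕ) (hp : p.Prime) (F : Finset (Finset (Fin n))) :
    ∃ c, IsKneserColoring n p (kneserChrom n p F) F c := by
  classical
  have hne : {t | ∃ c, IsKneserColoring n p t F c}.Nonempty := by
    refine ⟨F.card, fun A => if h : A ∈ F then (F.equivFin ⟨A, h⟩).val + 1 else 0, ?_, ?_⟩
    · intro A hA
      have := (F.equivFin ⟨A, hA⟩).isLt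
      simp only [hA, dif_pos, Finset.mem_Icc]
      omega
    · rintro E hE hcard - ⟨j, hj⟩
      have h2 := hp.two_le
      obtain ⟨A, hA, B, hB, hAB⟩ := Finset.one_lt_card.1 (show 1 < E.card by omega)
      have h := (hj A hA).trans (hj B hB).symm
      simp only [hE hA, hE hB, dif_pos] at h
      have h' := F.equivFin.injective (Fin.ext (by omega :
        (F.equivFin ⟨A, hE hA⟩).val = (F.equivFin ⟨B, hE hB⟩).val))
      exact hAB (congrArg Subtype.val h')
  exact Nat.sInf_mem hne

end ZpT

theorem stmt1 (n p : ℕ) (hp : p.Prime) (F : Finset (Finset (Fin n)))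
    (hF : ∀ A ∈ F, A.Nonempty) (i : ℕ) (hi : 1 ≤ i)
    (hile : i ≤ kneserChrom n p F + 1) :
    ((n : ℚ) - (altNumI n p F i : ℚ)) / ((p : ℚ) - 1) + (i : ℚ) - 1
      ≤ (kneserChrom n p F : ℚ) := by
  have hne : {k | ∃ σ : Equiv.Perm (Fin n), altHypI n p σ F i = k}.Nonempty := ⟨_, 1, rfl⟩
  obtain ⟨σ, hσ⟩ := Nat.sInf_mem hne
  have hσ' : altHypI n p σ F i = altNumI n p F i := hσ
  obtain ⟨c, hc⟩ := ZpT.exists_coloring n p hp F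
  have h := ZpT.main_bound n p hp F hF i hi _ hile c hc σ
  rw [hσ'] at h
  have hp2 := hp.two_le
  have hq : (n : ℚ) ≤ altNumI n p F i + (kneserChrom n p F + 1 - i) * (p - 1) := by
    have h' : ((n : ℕ) : ℚ) ≤
      ((altNumI n p F i + (kneserChrom n p F + 1 - i) * (p - 1) : ℕ) : ℚ) := by exact_mod_cast h
    rw [Nat.cast_add, Nat.cast_mul, Nat.cast_sub hile, Nat.cast_sub (by omega)] at h'
    push_cast at h'
    exact h'
  have hp' : (0 : ℚ) < (p : ℚ) - 1 := by
    have : (2 : ℚ) ≤ p := by exact_mod_cast hp2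
    linarith
  have : ((n : ℚ) - (altNumI n p F i : ℚ)) / ((p : ℚ) - 1) ≤ kneserChrom n p F + 1 - i := by
    rw [div_le_iff₀ hp']
    linarith
  linarith
end

section
/- (Dol'nikov–Kříž) For every hypergraph F on vertex set [n] and every integer r ≥ 2, χ(KG^r(F)) ≥ cd_r(F) / (r − 1). -/
open Finset

/-- The hypergraph `F` (on vertex set `[n]`) admits a proper coloring with `r` colors:
no member of `F` is monochromatic. -/
def HypColorable (n r : ℕ) (F : Finset (Finset (Fin n))) : Prop :=
  ∃ c : Fin n → Fin r, ∀ A ∈ F, ¬ ∃ j, ∀ a ∈ A, c a = j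

open Classical in
/-- `M_r(F)`: the maximum size of a subset `T ⊆ [n]` such that the hypergraph
`{A ∈ F : A ⊆ T}` admits a proper `r`-coloring. -/
noncomputable def Mr (n r : ℕ) (F : Finset (Finset (Fin n))) : ℕ :=
  sSup {k | ∃ T : Finset (Fin n), T.card = k ∧
    HypColorable n r (F.filter fun A => A ⊆ T)}

/-- The `r`-colorability defect `cd_r(F) = n - M_r(F)`: the minimum number of vertices
whose removal leaves an induced hypergraph that is properly `r`-colorable. -/
noncomputable def cdr (n r : ℕ) (F : Finset (Finset (Fin n))) : ℕ := n - Mr n r F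


namespace Kriz

/-- Chains: formal combinations of lists. -/
abbrev Ch (p : ℕ) (P : Type*) := List P →₀ ZMod p

variable {p : ℕ} {P Q : Type*}

noncomputable def consL (p : ℕ) (x : P) : Ch p P →ₗ[ZMod p] Ch p P :=
  Finsupp.linearCombination (ZMod p) (fun w => Finsupp.single (x :: w) 1)

noncomputable def mapL (p : ℕ) (f : P → Q) : Ch p P →ₗ[ZMod p] Ch p Q :=
  Finsupp.linearCombination (ZMod p) (fun w => Finsupp.single (w.map f) 1)

noncomputable def bdW (p : ℕ) : List P → Ch p P
  | [] => 0
  | x :: w => Finsupp.single w 1 - consL p x (bdW p w)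

noncomputable def bd (p : ℕ) : Ch p P →ₗ[ZMod p] Ch p P :=
  Finsupp.linearCombination (ZMod p) (bdW p)

noncomputable def prW (p : ℕ) (f : P → P) : List P → Ch p P
  | [] => 0
  | x :: w => Finsupp.single (x :: f x :: w.map f) 1 - consL p x (prW p f w)

noncomputable def pr (p : ℕ) (f : P → P) : Ch p P →ₗ[ZMod p] Ch p P :=
  Finsupp.linearCombination (ZMod p) (prW p f)

/-- cone -/
noncomputable def cone (p : ℕ) (e : P) (f : P → P) : Ch p P →ₗ[ZMod p] Ch p P :=
  consL p e ∘ₗ mapL p f - pr p f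

@[simp] lemma consL_single (x : P) (w : List P) :
    consL p x (Finsupp.single w 1) = Finsupp.single (x :: w) 1 := by simp [consL]
@[simp] lemma mapL_single (f : P → Q) (w : List P) :
    mapL p f (Finsupp.single w 1) = Finsupp.single (w.map f) 1 := by simp [mapL]
@[simp] lemma bd_single (w : List P) :
    bd p (Finsupp.single w 1) = bdW p w := by simp [bd]
@[simp] lemma pr_single (f : P → P) (w : List P) :
    pr p f (Finsupp.single w 1) = prW p f w := by simp [pr]

lemma ch_ext {M : Type*} [AddCommMonoid M] [Module (ZMod p) M] {φ ψ : Ch p P →ₗ[ZMod p] M}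
    (h : ∀ w, φ (Finsupp.single w 1) = ψ (Finsupp.single w 1)) (c : Ch p P) : φ c = ψ c := by
  have : φ = ψ := by
    apply Finsupp.lhom_ext'
    intro w
    apply LinearMap.ext_ring
    simpa using h w
  rw [this]

lemma bd_cons (x : P) (c : Ch p P) : bd p (consL p x c) = c - consL p x (bd p c) := by
  have := ch_ext (φ := bd p ∘ₗ consL p x) (ψ := LinearMap.id - consL p x ∘ₗ bd p)
    (fun w => by simp [bdW]) c
  simpa using this

lemma map_cons (f : P → Q) (x : P) (c : Ch p P) :
    mapL p f (consL p x c) = consL p (f x) (mapL p f c) := by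
  have := ch_ext (φ := mapL p f ∘ₗ consL p x) (ψ := consL p (f x) ∘ₗ mapL p f)
    (fun w => by simp) c
  simpa using this

lemma map_map {S : Type*} (f : P → Q) (g : Q → S) (c : Ch p P) :
    mapL p g (mapL p f c) = mapL p (g ∘ f) c := by
  have := ch_ext (φ := mapL p g ∘ₗ mapL p f) (ψ := mapL p (g ∘ f))
    (fun w => by simp) c
  simpa using this

lemma map_id' (c : Ch p P) : mapL p id c = c := by
  have := ch_ext (φ := mapL p id) (ψ := LinearMap.id (M := Ch p P))
    (fun w => by simp) c
  simpa using this

lemma bdW_map (f : P → Q) (w : List P) : bdW p (w.map f) = mapL p f (bdW p w) := by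
  induction w with
  | nil => simp [bdW]
  | cons x w ih => simp [bdW, ih, map_cons]

lemma bd_map (f : P → Q) (c : Ch p P) : bd p (mapL p f c) = mapL p f (bd p c) := by
  have := ch_ext (φ := bd p ∘ₗ mapL p f) (ψ := mapL p f ∘ₗ bd p)
    (fun w => by simp [bdW_map]) c
  simpa using this

lemma pr_cons (f : P → P) (x : P) (c : Ch p P) :
    pr p f (consL p x c) = consL p x (consL p (f x) (mapL p f c)) - consL p x (pr p f c) := by
  have := ch_ext (φ := pr p f ∘ₗ consL p x)
    (ψ := consL p x ∘ₗ consL p (f x) ∘ₗ mapL p f - consL p x ∘ₗ pr p f)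
    (fun w => by simp [prW]) c
  simpa using this

lemma bd_prW (f : P → P) (w : List P) :
    bd p (prW p f w) + pr p f (bdW p w) = Finsupp.single (w.map f) 1 - Finsupp.single w 1 := by
  induction w with
  | nil => simp [prW, bdW]
  | cons x w ih =>
    have ih' : bd p (prW p f w) = Finsupp.single (w.map f) 1 - Finsupp.single w 1
      - pr p f (bdW p w) := by rw [← ih]; abel
    simp only [prW, bdW, map_sub, bd_single, bd_cons, pr_single, pr_cons, ih', bdW_map,
      consL_single, List.map_cons]
    abel

lemma bd_cone (e : P) (f : P → P) (c : Ch p P) :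
    bd p (cone p e f c) = c - cone p e f (bd p c) := by
  have := ch_ext (φ := bd p ∘ₗ cone p e f) (ψ := LinearMap.id - cone p e f ∘ₗ bd p)
    (fun w => by
      have h := bd_prW (p := p) f w
      have ih' : bd p (prW p f w) = Finsupp.single (w.map f) 1 - Finsupp.single w 1
        - pr p f (bdW p w) := by rw [← h]; abel
      simp only [cone, bdW, ih', bdW_map, LinearMap.comp_apply, LinearMap.sub_apply, map_sub,
        mapL_single, consL_single, pr_single, bd_single, LinearMap.id_apply]
      abel) c
  simpa using this

/-! ### cochains on labels -/

def c1 (x y : ZMod p) : ZMod p := if y.val < x.val then 1 else 0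

def tau (x y z : ZMod p) : ZMod p := c1 y z - c1 x z + c1 x y

def coE : List (ZMod p) → ZMod p
  | [] => 0
  | [_] => 1
  | [_, _] => 0
  | x :: y :: z :: w => tau x y z * coE (z :: w)

def coO : List (ZMod p) → ZMod p
  | [] => 1
  | [_] => 0
  | x :: y :: w => c1 x y * coE (y :: w)

def coV : List (ZMod p) → ZMod p
  | [] => 0
  | x :: w => if x = -1 then coE (x :: w) else 0

noncomputable def lin (φ : List (ZMod p) → ZMod p) : Ch p (ZMod p) →ₗ[ZMod p] ZMod p :=
  Finsupp.linearCombination (ZMod p) φ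

@[simp] lemma lin_single (φ : List (ZMod p) → ZMod p) (w : List (ZMod p)) :
    lin φ (Finsupp.single w 1) = φ w := by simp [lin]

lemma E_cons3 (x y z : ZMod p) (c : Ch p (ZMod p)) :
    lin coE (consL p x (consL p y (consL p z c))) = tau x y z * lin coE (consL p z c) := by
  have := ch_ext (φ := lin coE ∘ₗ consL p x ∘ₗ consL p y ∘ₗ consL p z)
    (ψ := tau x y z • (lin coE ∘ₗ consL p z))
    (fun w => by simp [coE]) c
  simpa using this

lemma E_bdW : ∀ w : List (ZMod p), lin coE (bdW p w) = 0
  | [] => by simp [bdW]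
  | [x] => by simp [bdW, coE]
  | [x, y] => by simp [bdW, coE]
  | [x, y, z] => by simp [bdW, coE]
  | x :: y :: z :: a :: v => by
    have h := E_bdW (z :: a :: v)
    rw [bdW, map_sub, lin_single, sub_eq_zero] at h
    rw [bdW, bdW, bdW]
    simp only [map_sub, consL_single, lin_single, E_cons3, ← h]
    simp only [coE, tau]
    ring
termination_by w => w.length

lemma O_cons2 (x y : ZMod p) (c : Ch p (ZMod p)) :
    lin coO (consL p x (consL p y c)) = c1 x y * lin coE (consL p y c) := by
  have := ch_ext (φ := lin coO ∘ₗ consL p x ∘ₗ consL p y)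
    (ψ := c1 x y • (lin coE ∘ₗ consL p y))
    (fun w => by simp [coO]) c
  simpa using this

lemma V_cons (x : ZMod p) (c : Ch p (ZMod p)) :
    lin coV (consL p x c) = if x = -1 then lin coE (consL p x c) else 0 := by
  have := ch_ext (φ := lin coV ∘ₗ consL p x)
    (ψ := (if x = -1 then 1 else 0 : ZMod p) • (lin coE ∘ₗ consL p x))
    (fun w => by by_cases hx : x = -1 <;> simp [coV, hx]) c
  by_cases hx : x = -1 <;> simpa [hx] using this

lemma O_bdW : ∀ w : List (ZMod p), lin coO (bdW p w) = coE w
  | [] => by simp [bdW, coE]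
  | [x] => by simp [bdW, coO, coE]
  | [x, y] => by simp [bdW, coO, coE]
  | x :: y :: a :: v => by
    have h := E_bdW (y :: a :: v)
    rw [bdW, map_sub, lin_single, sub_eq_zero] at h
    rw [bdW, bdW]
    simp only [map_sub, consL_single, lin_single, O_cons2, ← h]
    simp only [coE, coO, tau]
    ring

lemma c1_shift [Fact p.Prime] (x y : ZMod p) :
    c1 (x + 1) (y + 1) - c1 x y = (if y = -1 then 1 else 0) - (if x = -1 then 1 else 0) := by
  have hp : p.Prime := Fact.out
  have key : ∀ x : ZMod p, (x = -1 ∧ x.val = p - 1 ∧ (x + 1).val = 0) ∨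
      (x ≠ -1 ∧ x.val < p - 1 ∧ (x + 1).val = x.val + 1) := by
    intro x
    have hx := ZMod.val_lt x
    by_cases h : x = -1
    · left
      refine ⟨h, ?_, ?_⟩
      · subst h
        obtain ⟨q, rfl⟩ : ∃ q, p = q + 1 := ⟨p - 1, by have := hp.pos; omega⟩
        rw [ZMod.val_neg_one]; rfl
      · subst h; simp
    · right
      have h0 : x.val ≠ p - 1 := by
        intro h1
        apply h
        have : ((x.val : ℕ) : ZMod p) = ((p - 1 : ℕ) : ZMod p) := by rw [h1]
        rw [ZMod.natCast_zmod_val, Nat.cast_sub hp.one_le] at this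
        simpa using this
      refine ⟨h, by omega, ?_⟩
      rw [ZMod.val_add, ZMod.val_one, Nat.mod_eq_of_lt (by omega)]
  rcases key x with ⟨h1, h2, h3⟩ | ⟨h1, h2, h3⟩ <;>
  rcases key y with ⟨h4, h5, h6⟩ | ⟨h4, h5, h6⟩ <;>
  simp only [c1, h1, h4, h3, h6] <;> simp_all; omega

lemma tau_shift [Fact p.Prime] (x y z : ZMod p) : tau (x + 1) (y + 1) (z + 1) = tau x y z := by
  have h1 := c1_shift x y
  have h2 := c1_shift x z
  have h3 := c1_shift y z
  simp only [tau]
  linear_combination h3 - h2 + h1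

lemma E_shift1 [Fact p.Prime] : ∀ w : List (ZMod p), coE (w.map (· + 1)) = coE w
  | [] => by simp
  | [x] => by simp [coE]
  | [x, y] => by simp [coE]
  | x :: y :: z :: w => by
    have := E_shift1 (z :: w)
    simp only [List.map_cons] at this
    simp only [List.map_cons, coE, tau_shift, this]
termination_by w => w.length

lemma zmod_const [Fact p.Prime] {α : Type*} (a : ZMod p → α) (h : ∀ j, a (j + 1) = a j)
    (j : ZMod p) : a j = a 0 := by
  have : ∀ k : ℕ, a (k : ZMod p) = a 0 := by
    intro k
    induction k with
    | zero => simp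
    | succ k ih => rw [Nat.cast_succ, h, ih]
  rw [← ZMod.natCast_zmod_val j]; exact this _

lemma E_shift [Fact p.Prime] (w : List (ZMod p)) (j : ZMod p) :
    coE (w.map (· + j)) = coE w := by
  have := zmod_const (fun j => coE (w.map (· + j))) (fun j => by
    have := E_shift1 (w.map (· + j))
    simp only [List.map_map] at this
    rw [← this]; congr 2; funext x; simp [add_assoc]) j
  simpa using this

lemma V_bdW [Fact p.Prime] : ∀ w : List (ZMod p),
    lin coV (bdW p w) = coO (w.map (· + 1)) - coO w
  | [] => by simp [bdW, coO]
  | [x] => by simp [bdW, coO, coV]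
  | x :: y :: u => by
    have h := E_bdW (x :: y :: u)
    have hs := E_shift1 (y :: u)
    rw [bdW, bdW] at h
    rw [bdW, bdW]
    have h1 := c1_shift x y
    simp only [map_sub, consL_single, lin_single, V_cons, List.map_cons] at h hs ⊢
    simp only [coO, coV, hs]
    rw [← sub_mul, h1]
    split_ifs <;> simp_all; linear_combination h

lemma E_bd (c : Ch p (ZMod p)) : lin coE (bd p c) = 0 := by
  have := ch_ext (φ := lin coE ∘ₗ bd p) (ψ := 0) (fun w => by simp [E_bdW]) c
  simpa using this

lemma O_bd (c : Ch p (ZMod p)) : lin coO (bd p c) = lin coE c := by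
  have := ch_ext (φ := lin coO ∘ₗ bd p) (ψ := lin coE) (fun w => by simp [O_bdW]) c
  simpa using this

lemma V_bd [Fact p.Prime] (c : Ch p (ZMod p)) :
    lin coV (bd p c) = lin coO (mapL p (· + 1) c) - lin coO c := by
  have := ch_ext (φ := lin coV ∘ₗ bd p) (ψ := lin coO ∘ₗ mapL p (· + 1) - lin coO)
    (fun w => by simp [V_bdW]) c
  simpa using this

lemma V_sum [Fact p.Prime] (c : Ch p (ZMod p)) :
    ∑ j : ZMod p, lin coV (mapL p (· + j) c) = lin coE c := by
  have := ch_ext (φ := ∑ j : ZMod p, lin coV ∘ₗ mapL p (· + j)) (ψ := lin coE)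
    (fun w => by
      simp only [LinearMap.sum_apply, LinearMap.comp_apply, mapL_single, lin_single]
      cases w with
      | nil => simp [coV, coE]
      | cons x w =>
        have h : ∀ j : ZMod p, coE ((x + j) :: w.map (· + j)) = coE (x :: w) := fun j => by
          have := E_shift (x :: w) j
          simpa using this
        simp only [List.map_cons, coV, h]
        rw [Finset.sum_eq_single (-1 - x)]
        · simp
        · intro b _ hb
          rw [if_neg]
          intro h; apply hb; rw [← h]; ring
        · simp) c
  simpa [LinearMap.sum_apply] using this

lemma tau_ne {x y z : ZMod p} (h : tau x y z ≠ 0) : x ≠ y ∧ y ≠ z := by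
  constructor <;> rintro rfl <;> simp [tau, c1] at h

lemma coE_alt : ∀ w : List (ZMod p), coE w ≠ 0 → w.IsChain (· ≠ ·)
  | [] => by simp
  | [x] => by simp
  | [x, y] => by simp [coE]
  | x :: y :: z :: w => by
    intro h
    simp only [coE] at h
    have h1 := tau_ne (left_ne_zero_of_mul h)
    have h2 := coE_alt (z :: w) (right_ne_zero_of_mul h)
    simp only [List.isChain_cons_cons]
    exact ⟨h1.1, h1.2, h2⟩
termination_by w => w.length

lemma coO_alt : ∀ w : List (ZMod p), coO w ≠ 0 → w.IsChain (· ≠ ·)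
  | [] => by simp
  | [x] => by simp
  | x :: y :: w => by
    intro h
    simp only [coO] at h
    have h2 := coE_alt (y :: w) (right_ne_zero_of_mul h)
    simp only [List.isChain_cons_cons]
    refine ⟨?_, h2⟩
    rintro rfl
    simp [c1] at h

end Kriz
namespace Kriz

variable {p : ℕ} {P Q : Type*}

lemma lc_mem {M : Type*} [AddCommMonoid M] [Module (ZMod p) M] (φ : List P → M)
    (N : Submodule (ZMod p) M) (S : Set (List P)) (h : ∀ w ∈ S, φ w ∈ N) (c : Ch p P)
    (hc : c ∈ Finsupp.supported (ZMod p) (ZMod p) S) :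
    Finsupp.linearCombination (ZMod p) φ c ∈ N := by
  rw [Finsupp.linearCombination_apply, Finsupp.sum]
  refine Submodule.sum_mem _ (fun w hw => N.smul_mem _ (h w ?_))
  exact (Finsupp.mem_supported _ _).1 hc hw

lemma prW_mem (le : P → P → Prop) (htr : ∀ a b c, le a b → le b c → le a c)
    (f : P → P) (hf : ∀ a b, le a b → le (f a) (f b)) (w : List P)
    (hw : w.Pairwise le) (hle : ∀ x ∈ w, le x (f x)) :
    prW p f w ∈ Finsupp.supported (ZMod p) (ZMod p)
      {w' : List P | w'.length = w.length + 1 ∧ w'.Pairwise le ∧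
        ∀ y ∈ w', y ∈ w ∨ ∃ z ∈ w, y = f z} := by
  induction w with
  | nil => simp [prW]
  | cons x w ih =>
    rw [List.pairwise_cons] at hw
    have ih := ih hw.2 (fun y hy => hle y (by simp [hy]))
    have hx := hle x (by simp)
    have hle' : ∀ y ∈ w, le y (f y) := fun y hy => hle y (by simp [hy])
    rw [prW]
    refine Submodule.sub_mem _ ?_ ?_
    · apply Finsupp.single_mem_supported
      refine ⟨by simp, ?_, ?_⟩
      · simp only [List.pairwise_cons, List.mem_cons, List.mem_map]
        refine ⟨?_, ?_, ?_⟩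
        · rintro y (rfl | ⟨z, hz, rfl⟩)
          · exact hx
          · exact htr _ _ _ (hw.1 z hz) (hle' z hz)
        · rintro y ⟨z, hz, rfl⟩
          exact hf _ _ (hw.1 z hz)
        · rw [List.pairwise_map]
          exact hw.2.imp (fun h => hf _ _ h)
      · simp only [List.mem_cons, List.mem_map]
        rintro y (rfl | rfl | ⟨z, hz, rfl⟩)
        · simp
        · right; exact ⟨x, by simp, rfl⟩
        · right; exact ⟨z, by simp [hz], rfl⟩
    · refine lc_mem _ _ _ ?_ _ ih
      rintro w' ⟨h1, h2, h3⟩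
      apply Finsupp.single_mem_supported
      refine ⟨by simp [h1], ?_, ?_⟩
      · rw [List.pairwise_cons]
        refine ⟨fun y hy => ?_, h2⟩
        rcases h3 y hy with h | ⟨z, hz, rfl⟩
        · exact hw.1 y h
        · exact htr _ _ _ (hw.1 z hz) (hle' z hz)
      · intro y hy
        rcases List.mem_cons.1 hy with rfl | hy
        · simp
        · rcases h3 y hy with h | ⟨z, hz, rfl⟩
          · simp [h]
          · right; exact ⟨z, by simp [hz], rfl⟩

/-- Norm operator. -/
noncomputable def nm [NeZero p] (act : ZMod p → P → P) (h : Ch p P) : Ch p P :=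
  ∑ j : ZMod p, mapL p (act j) h

section step
variable [Fact p.Prime] (act : ZMod p → P → P) (s : P → ZMod p)

lemma map_s_act (hs : ∀ j x, s (act j x) = s x + j)
    (j : ZMod p) (c : Ch p P) :
    mapL p s (mapL p (act j) c) = mapL p (· + j) (mapL p s c) := by
  rw [map_map, map_map]; congr 2; funext x; simp [hs]

lemma act_comp (act_add : ∀ a b x, act (a + b) x = act a (act b x))
    (a b : ZMod p) (c : Ch p P) :
    mapL p (act a) (mapL p (act b) c) = mapL p (act (a + b)) c := by
  rw [map_map]; congr 2; funext x; simp [act_add]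

lemma act_nm (act_add : ∀ a b x, act (a + b) x = act a (act b x))
    (h : Ch p P) : mapL p (act 1) (nm act h) = nm act h := by
  simp only [nm, map_sum, act_comp act act_add]
  exact Fintype.sum_equiv (Equiv.addLeft 1) _ _ (fun j => rfl)

lemma nm_act (act_add : ∀ a b x, act (a + b) x = act a (act b x))
    (h : Ch p P) : nm act (mapL p (act 1) h) = nm act h := by
  simp only [nm, act_comp act act_add]
  exact Fintype.sum_equiv (Equiv.addRight 1) _ _ (fun j => rfl)

lemma nm_sub (h h' : Ch p P) : nm act (h - h') = nm act h - nm act h' := by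
  simp [nm]

lemma bd_nm (h : Ch p P) : bd p (nm act h) = nm act (bd p h) := by
  simp [nm, bd_map]

/-- invariant of the even stage -/
def EvenOK (h : Ch p P) : Prop :=
  bd p (mapL p (act 1) h - h) = 0 ∧ lin coE (mapL p s h) = 1

/-- invariant of the odd stage -/
def OddOK (h : Ch p P) : Prop :=
  bd p (nm act h) = 0 ∧ lin coO (mapL p s (nm act h)) = 1

lemma even_step (act_add : ∀ a b x, act (a + b) x = act a (act b x))
    (hs : ∀ j x, s (act j x) = s x + j) (e : P) (f : P → P) (h : Ch p P) (hh : EvenOK act s h) :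
    OddOK act s (cone p e f (mapL p (act 1) h - h)) := by
  set h' := cone p e f (mapL p (act 1) h - h) with hh'
  have hb : bd p h' = mapL p (act 1) h - h := by
    rw [hh', bd_cone, hh.1]; simp
  refine ⟨?_, ?_⟩
  · rw [bd_nm, hb, nm_sub, nm_act act act_add, sub_self]
  · have key := zmod_const (fun j : ZMod p => lin coO (mapL p s (mapL p (act j) h')) -
        lin coV (mapL p s (mapL p (act j) h))) (fun j => by
      have h1 := V_bd (mapL p s (mapL p (act j) h'))
      rw [bd_map, bd_map, hb, map_sub, map_sub, map_sub, act_comp act act_add,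
        ← map_s_act act s hs, act_comp act act_add, add_comm 1 j] at h1
      linear_combination -h1)
    have hsum : ∑ j : ZMod p, (lin coO (mapL p s (mapL p (act j) h')) -
        lin coV (mapL p s (mapL p (act j) h))) = 0 := by
      rw [Finset.sum_congr rfl (fun j _ => key j)]
      simp
    rw [Finset.sum_sub_distrib, sub_eq_zero] at hsum
    simp only [nm, map_sum]
    rw [hsum]
    simp only [map_s_act act s hs]
    rw [V_sum, hh.2]

lemma odd_step (act_add : ∀ a b x, act (a + b) x = act a (act b x))
    (e : P) (f : P → P) (h : Ch p P) (hh : OddOK act s h) :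
    EvenOK act s (cone p e f (nm act h)) := by
  set h' := cone p e f (nm act h) with hh'
  have hb : bd p h' = nm act h := by
    rw [hh', bd_cone, hh.1]; simp
  refine ⟨?_, ?_⟩
  · rw [map_sub, bd_map, hb, act_nm act act_add, sub_self]
  · rw [← O_bd, bd_map, hb, hh.2]

lemma base (e : P) : EvenOK act s (Finsupp.single [e] 1) := by
  constructor
  · simp [bdW]
  · simp [coE]

end step

/-- nonzero sign vectors -/
def Vec (p n : ℕ) := {X : Fin n → Option (ZMod p) // ∃ i a, X i = some a}

def Vec.le {n : ℕ} (X Y : Vec p n) : Prop := ∀ i a, X.1 i = some a → Y.1 i = some a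

def vact {n : ℕ} (j : ZMod p) (X : Vec p n) : Vec p n :=
  ⟨fun i => (X.1 i).map (· + j), by
    obtain ⟨i, a, h⟩ := X.2
    exact ⟨i, a + j, by simp [h]⟩⟩

def vupd {n : ℕ} (k : Fin n) (X : Vec p n) : Vec p n :=
  ⟨Function.update X.1 k (some 0), ⟨k, 0, by simp⟩⟩

def vone {n : ℕ} (k : Fin n) : Vec p n :=
  ⟨Function.update (fun _ => none) k (some 0), ⟨k, 0, by simp⟩⟩

def Good (p n k : ℕ) : Set (List (Vec p n)) :=
  {w | w.length = k ∧ w.Pairwise Vec.le ∧ ∀ X ∈ w, ∀ i : Fin n, k ≤ i.1 → X.1 i = none}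

lemma good_act {n k : ℕ} (j : ZMod p) (h : Ch p (Vec p n))
    (hh : h ∈ Finsupp.supported (ZMod p) (ZMod p) (Good p n k)) :
    mapL p (vact j) h ∈ Finsupp.supported (ZMod p) (ZMod p) (Good p n k) := by
  refine lc_mem _ _ _ ?_ _ hh
  rintro w ⟨h1, h2, h3⟩
  apply Finsupp.single_mem_supported
  refine ⟨by simp [h1], ?_, ?_⟩
  · rw [List.pairwise_map]
    refine h2.imp ?_
    intro X Y hXY i a ha
    simp only [vact, Option.map_eq_some_iff] at ha ⊢
    obtain ⟨b, hb, rfl⟩ := ha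
    exact ⟨b, hXY i b hb, rfl⟩
  · intro X hX i hi
    obtain ⟨Y, hY, rfl⟩ := List.mem_map.1 hX
    simp [vact, h3 Y hY i hi]

lemma good_cone {n k : ℕ} (hk : k < n) (h : Ch p (Vec p n))
    (hh : h ∈ Finsupp.supported (ZMod p) (ZMod p) (Good p n k)) :
    cone p (vone ⟨k, hk⟩) (vupd ⟨k, hk⟩) h ∈
      Finsupp.supported (ZMod p) (ZMod p) (Good p n (k + 1)) := by
  have htr : ∀ a b c : Vec p n, a.le b → b.le c → a.le c :=
    fun a b c h1 h2 i x hx => h2 i x (h1 i x hx)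
  have hf : ∀ a b : Vec p n, a.le b → (vupd ⟨k, hk⟩ a).le (vupd ⟨k, hk⟩ b) := by
    intro a b hab i x hx
    by_cases hi : i = ⟨k, hk⟩
    · subst hi; simpa [vupd] using hx
    · simp only [vupd, Function.update_of_ne hi] at hx ⊢
      exact hab i x hx
  have hlev : ∀ X : Vec p n, (∀ i : Fin n, k ≤ i.1 → X.1 i = none) →
      ∀ i : Fin n, k + 1 ≤ i.1 → (vupd ⟨k, hk⟩ X).1 i = none := by
    intro X hX i hi
    have : i ≠ ⟨k, hk⟩ := by rintro rfl; simp at hi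
    simp only [vupd, Function.update_of_ne this]
    exact hX i (by omega)
  have hle : ∀ X : Vec p n, (∀ i : Fin n, k ≤ i.1 → X.1 i = none) →
      X.le (vupd ⟨k, hk⟩ X) := by
    intro X hX i a ha
    have : i ≠ ⟨k, hk⟩ := by rintro rfl; rw [hX _ le_rfl] at ha; simp at ha
    simpa only [vupd, Function.update_of_ne this] using ha
  have hone : ∀ X : Vec p n, (vone ⟨k, hk⟩ : Vec p n).le (vupd ⟨k, hk⟩ X) := by
    intro X i a ha
    by_cases hi : i = ⟨k, hk⟩
    · subst hi; simpa [vone, vupd] using ha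
    · simp [vone, Function.update_of_ne hi] at ha
  rw [cone, LinearMap.sub_apply]
  refine Submodule.sub_mem _ ?_ ?_
  · have hm : (consL p (vone ⟨k, hk⟩) ∘ₗ mapL p (vupd ⟨k, hk⟩)) h =
        Finsupp.linearCombination (ZMod p)
          (fun w => Finsupp.single (vone ⟨k, hk⟩ :: w.map (vupd ⟨k, hk⟩)) 1) h :=
      ch_ext (fun w => by simp) h
    rw [hm]
    refine lc_mem _ _ _ ?_ _ hh
    rintro w ⟨h1, h2, h3⟩
    apply Finsupp.single_mem_supported
    refine ⟨by simp [h1], ?_, ?_⟩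
    · rw [List.pairwise_cons, List.pairwise_map]
      refine ⟨?_, h2.imp (fun h => hf _ _ h)⟩
      intro Y hY
      obtain ⟨Z, hZ, rfl⟩ := List.mem_map.1 hY
      exact hone Z
    · intro X hX i hi
      rcases List.mem_cons.1 hX with rfl | hX
      · have : i ≠ ⟨k, hk⟩ := by rintro rfl; simp at hi
        simp [vone, Function.update_of_ne this]
      · obtain ⟨Z, hZ, rfl⟩ := List.mem_map.1 hX
        exact hlev Z (h3 Z hZ) i hi
  · refine lc_mem _ _ _ ?_ _ hh
    rintro w ⟨h1, h2, h3⟩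
    refine Finsupp.supported_mono ?_ (prW_mem Vec.le htr _ hf w h2 (fun X hX => hle X (h3 X hX)))
    rintro w' ⟨h4, h5, h6⟩
    refine ⟨by omega, h5, ?_⟩
    intro X hX i hi
    rcases h6 X hX with h | ⟨Z, hZ, rfl⟩
    · exact h3 X h i (by omega)
    · exact hlev Z (h3 Z hZ) i hi

lemma stage [Fact p.Prime] {n : ℕ} (s : Vec p n → ZMod p) (hs : ∀ j x, s (vact j x) = s x + j)
    (k : ℕ) (hk : k < n) : ∃ h ∈ Finsupp.supported (ZMod p) (ZMod p) (Good p n (k + 1)),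
      EvenOK vact s h ∨ OddOK vact s h := by
  have act_add : ∀ (a b : ZMod p) (x : Vec p n), vact (a + b) x = vact a (vact b x) := by
    intro a b x
    apply Subtype.ext
    funext i
    simp only [vact, Option.map_map]
    congr 1
    funext y
    simp; ring
  induction k with
  | zero =>
    refine ⟨Finsupp.single [vone ⟨0, hk⟩] 1, ?_, Or.inl (base _ _ _)⟩
    apply Finsupp.single_mem_supported
    refine ⟨by simp, by simp, ?_⟩
    intro X hX i hi
    rw [List.mem_singleton] at hX
    subst hX
    have : i ≠ ⟨0, hk⟩ := by rintro rfl; simp at hi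
    simp [vone, Function.update_of_ne this]
  | succ k ih =>
    obtain ⟨h, hh, h1 | h1⟩ := ih (by omega)
    · exact ⟨_, good_cone hk _ (Submodule.sub_mem _ (good_act 1 h hh) hh),
        Or.inr (even_step vact s act_add hs _ _ h h1)⟩
    · exact ⟨_, good_cone hk _ (Submodule.sum_mem _ (fun j _ => good_act j h hh)),
        Or.inl (odd_step vact s act_add _ _ h h1)⟩

lemma exists_ne {s : P → ZMod p} {φ : List (ZMod p) → ZMod p} {S : Set (List P)} {c : Ch p P}
    (hc : c ∈ Finsupp.supported (ZMod p) (ZMod p) S) (h : lin φ (mapL p s c) ≠ 0) :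
    ∃ w ∈ S, φ (w.map s) ≠ 0 := by
  by_contra! hcon
  apply h
  have h1 : lin φ (mapL p s c) = Finsupp.linearCombination (ZMod p) (fun w => φ (w.map s)) c := by
    have := ch_ext (φ := lin φ ∘ₗ mapL p s)
      (ψ := Finsupp.linearCombination (ZMod p) (fun w => φ (w.map s))) (fun w => by simp) c
    simpa using this
  rw [h1]
  have := lc_mem (fun w => φ (w.map s)) ⊥ S (fun w hw => by simp [hcon w hw]) c hc
  simpa using this

lemma chain_exists [Fact p.Prime] {n : ℕ} (hn : 0 < n) (s : Vec p n → ZMod p)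
    (hs : ∀ j x, s (vact j x) = s x + j) :
    ∃ w : List (Vec p n), w.length = n ∧ w.IsChain Vec.le ∧ (w.map s).IsChain (· ≠ ·) := by
  obtain ⟨h, hh, h1⟩ := stage s hs (n - 1) (by omega)
  rw [Nat.sub_add_cancel hn] at hh
  have : ∃ w ∈ Good p n n, (w.map s).IsChain (· ≠ ·) := by
    rcases h1 with h1 | h1
    · obtain ⟨w, hw, hw'⟩ := exists_ne hh (s := s) (φ := coE) (by rw [h1.2]; exact one_ne_zero)
      exact ⟨w, hw, coE_alt _ hw'⟩
    · obtain ⟨w, hw, hw'⟩ := exists_ne (c := nm vact h)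
        (Submodule.sum_mem _ (fun j _ => good_act j h hh)) (s := s) (φ := coO)
        (by rw [h1.2]; exact one_ne_zero)
      exact ⟨w, hw, coO_alt _ hw'⟩
  obtain ⟨w, ⟨h2, h3, _⟩, h4⟩ := this
  exact ⟨w, h2, h3.isChain, h4⟩

end Kriz

namespace Kriz

/-- Kriz's theorem in a form suited for induction. -/
def KP (n : ℕ) (ι : Type) [Fintype ι] : Prop :=
  ∀ (F : Set (Finset (Fin n))) (t : ℕ) (c : Finset (Fin n) → ℕ),
    (∀ A ∈ F, A.Nonempty) → (∀ A ∈ F, c A < t) →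
    (¬ ∃ A : ι → Finset (Fin n), (∀ i, A i ∈ F) ∧ (∀ i j, i ≠ j → Disjoint (A i) (A j)) ∧
      ∀ i j, c (A i) = c (A j)) →
    ∃ X : Fin n → Option ι, (Finset.univ.filter (fun v => X v = none)).card ≤
      (Fintype.card ι - 1) * t ∧ ∀ j, ∀ A ∈ F, ∃ a ∈ A, X a ≠ some j

lemma chain_and {α : Type*} {R S T : α → α → Prop} (h : ∀ a b, R a b → S a b → T a b) :
    ∀ w : List α, w.IsChain R → w.IsChain S → w.IsChain T
  | [] => by simp
  | [x] => by simp
  | x :: y :: w => by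
    simp only [List.isChain_cons_cons]
    exact fun h1 h2 => ⟨h _ _ h1.1 h2.1, chain_and h (y :: w) h1.2 h2.2⟩

section prime
variable {p n : ℕ} [Fact p.Prime] (F : Set (Finset (Fin n))) (t : ℕ) (c : Finset (Fin n) → ℕ)

open Classical in
noncomputable def fib (X : Vec p n) (i : ℕ) : Finset (ZMod p) :=
  Finset.univ.filter (fun j => ∃ A ∈ F, c A = i ∧ ∀ a ∈ A, X.1 a = some j)

lemma mem_fib (X : Vec p n) (i : ℕ) (j : ZMod p) :
    j ∈ fib F c X i ↔ ∃ A ∈ F, c A = i ∧ ∀ a ∈ A, X.1 a = some j := by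
  simp [fib]

noncomputable def tot (X : Vec p n) : ℕ := ∑ i ∈ Finset.range t, (fib F c X i).card

def siz (X : Vec p n) : ℕ := (Finset.univ.filter (fun v => X.1 v ≠ none)).card

noncomputable def fst (X : Vec p n) : ZMod p := ((List.finRange n).findSome? X.1).getD 0

noncomputable def idx (X : Vec p n) : ℕ := sInf {i | i < t ∧ (fib F c X i).Nonempty}

noncomputable def avg (B : Finset (ZMod p)) : ZMod p := (B.card : ZMod p)⁻¹ * ∑ j ∈ B, j

noncomputable def sgn (X : Vec p n) : ZMod p :=
  if tot F t c X = 0 then fst X else avg (fib F c X (idx F t c X))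

lemma fst_act (j : ZMod p) (X : Vec p n) : fst (vact j X) = fst X + j := by
  have h : (List.finRange n).findSome? (vact j X).1 =
      ((List.finRange n).findSome? X.1).map (· + j) := by
    rw [List.map_findSome?]; rfl
  rw [fst, fst, h]
  have h2 : ((List.finRange n).findSome? X.1).isSome := by
    rw [List.findSome?_isSome_iff]
    obtain ⟨i, a, hi⟩ := X.2
    exact ⟨i, by simp, by simp [hi]⟩
  obtain ⟨y, hy⟩ := Option.isSome_iff_exists.1 h2
  simp [hy]

lemma fib_act (j : ZMod p) (X : Vec p n) (i : ℕ) :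
    fib F c (vact j X) i = (fib F c X i).map (addRightEmbedding j) := by
  ext k
  simp only [mem_fib, Finset.mem_map, addRightEmbedding_apply]
  simp only [vact, Option.map_eq_some_iff]
  constructor
  · rintro ⟨A, hA, hc, h⟩
    refine ⟨k - j, ⟨A, hA, hc, fun a ha => ?_⟩, by ring⟩
    obtain ⟨b, hb, rfl⟩ := h a ha
    simpa using hb
  · rintro ⟨m, ⟨A, hA, hc, h⟩, rfl⟩
    exact ⟨A, hA, hc, fun a ha => ⟨m, h a ha, rfl⟩⟩

lemma avg_shift (B : Finset (ZMod p)) (h0 : B.Nonempty) (h1 : B.card < p) (j : ZMod p) :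
    avg (B.map (addRightEmbedding j)) = avg B + j := by
  have hb : (B.card : ZMod p) ≠ 0 := by
    intro h
    rw [ZMod.natCast_eq_zero_iff] at h
    exact absurd (Nat.le_of_dvd h0.card_pos h) (by omega)
  simp only [avg, Finset.card_map, Finset.sum_map, addRightEmbedding_apply,
    Finset.sum_add_distrib, Finset.sum_const, nsmul_eq_mul]
  field_simp

lemma tot_act (j : ZMod p) (X : Vec p n) : tot F t c (vact j X) = tot F t c X := by
  simp [tot, fib_act]

lemma idx_act (j : ZMod p) (X : Vec p n) : idx F t c (vact j X) = idx F t c X := by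
  simp [idx, fib_act]

lemma idx_spec (X : Vec p n) (h : tot F t c X ≠ 0) :
    idx F t c X < t ∧ (fib F c X (idx F t c X)).Nonempty := by
  have : {i | i < t ∧ (fib F c X i).Nonempty}.Nonempty := by
    by_contra hcon
    apply h
    refine Finset.sum_eq_zero (fun i hi => ?_)
    rw [Finset.card_eq_zero]
    by_contra hne
    exact hcon ⟨i, Finset.mem_range.1 hi, Finset.nonempty_iff_ne_empty.2 hne⟩
  exact Nat.sInf_mem this

lemma fib_mono {X Y : Vec p n} (h : X.le Y) (i : ℕ) : fib F c X i ⊆ fib F c Y i := by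
  intro j
  simp only [fib, Finset.mem_filter, Finset.mem_univ, true_and]
  rintro ⟨A, hA, hc, h'⟩
  exact ⟨A, hA, hc, fun a ha => h _ _ (h' a ha)⟩

lemma tot_mono {X Y : Vec p n} (h : X.le Y) : tot F t c X ≤ tot F t c Y :=
  Finset.sum_le_sum (fun i _ => Finset.card_le_card (fib_mono F c h i))

lemma fib_eq {X Y : Vec p n} (h : X.le Y) (ht : tot F t c X = tot F t c Y) (i : ℕ) (hi : i < t) :
    fib F c X i = fib F c Y i := by
  have := (Finset.sum_eq_sum_iff_of_le
    (fun i _ => Finset.card_le_card (fib_mono F c h i))).1 ht i (Finset.mem_range.2 hi)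
  exact Finset.eq_of_subset_of_card_le (fib_mono F c h i) this.ge

lemma sgn_eq {X Y : Vec p n} (h : X.le Y) (ht : tot F t c X = tot F t c Y)
    (h0 : tot F t c X ≠ 0) : sgn F t c X = sgn F t c Y := by
  have hi : idx F t c X = idx F t c Y := by
    rw [idx, idx]
    congr 1
    ext i
    simp only [Set.mem_ofPred_eq]
    constructor <;> rintro ⟨h1, h2⟩ <;> refine ⟨h1, ?_⟩
    · rwa [← fib_eq F t c h ht i h1]
    · rwa [fib_eq F t c h ht i h1]
  rw [sgn, sgn, if_neg h0, if_neg (ht ▸ h0), ← hi,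
    fib_eq F t c h ht _ (idx_spec F t c X h0).1]

lemma siz_mono {X Y : Vec p n} (h : X.le Y) : siz X ≤ siz Y := by
  apply Finset.card_le_card
  intro v
  simp only [Finset.mem_filter, Finset.mem_univ, true_and]
  intro hv
  obtain ⟨a, ha⟩ := Option.ne_none_iff_exists'.1 hv
  rw [h v a ha]; simp

lemma siz_eq {X Y : Vec p n} (h : X.le Y) (hs : siz X = siz Y) : X = Y := by
  have hsub : Finset.univ.filter (fun v => X.1 v ≠ none) ⊆
      Finset.univ.filter (fun v => Y.1 v ≠ none) := by
    intro v
    simp only [Finset.mem_filter, Finset.mem_univ, true_and]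
    intro hv
    obtain ⟨a, ha⟩ := Option.ne_none_iff_exists'.1 hv
    rw [h v a ha]; simp
  have heq := Finset.eq_of_subset_of_card_le hsub (le_of_eq hs.symm)
  apply Subtype.ext
  funext v
  rcases hv : X.1 v with _ | a
  · by_contra hne
    have : v ∈ Finset.univ.filter (fun v => X.1 v ≠ none) := by
      rw [heq]; simpa using fun h => hne h.symm
    simp [hv] at this
  · exact (h v a hv).symm

lemma prime_case : KP n (ZMod p) := by
  intro F t c hF hc hno
  rw [ZMod.card]
  by_contra! hcon
  set M := (p - 1) * t with hM
  have hMn : M < n := by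
    have h : ¬ (Finset.univ.filter (fun v : Fin n => (none : Option (ZMod p)) = none)).card ≤ M := by
      intro h
      obtain ⟨j, A, hA, h⟩ := hcon (fun _ => none) h
      obtain ⟨a, ha⟩ := hF A hA
      simpa using h a ha
    simpa using h
  have hfib : ∀ (X : Vec p n) i, (fib F c X i).card < p := by
    intro X i
    by_contra! hge
    have huniv : fib F c X i = Finset.univ := by
      apply Finset.eq_univ_of_card
      rw [ZMod.card]
      refine le_antisymm ?_ hge
      simpa [ZMod.card] using Finset.card_le_univ (fib F c X i)
    have h1 : ∀ j : ZMod p, ∃ A ∈ F, c A = i ∧ ∀ a ∈ A, X.1 a = some j := by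
      intro j
      have : j ∈ fib F c X i := by rw [huniv]; simp
      simpa [fib] using this
    choose A hA hcA hX using h1
    refine hno ⟨A, hA, ?_, fun j k => by rw [hcA, hcA]⟩
    intro j k hjk
    rw [Finset.disjoint_left]
    intro a ha ha'
    have := hX j a ha
    rw [hX k a ha'] at this
    exact hjk (Option.some.inj this).symm
  have htot : ∀ X : Vec p n, tot F t c X ≤ M := by
    intro X
    calc tot F t c X ≤ ∑ i ∈ Finset.range t, (p - 1) :=
          Finset.sum_le_sum (fun i _ => by have := hfib X i; omega)
      _ = M := by simp [hM, mul_comm]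
  have hsiz : ∀ X : Vec p n, tot F t c X = 0 → siz X ≤ n - M - 1 := by
    intro X h0
    have h1 : siz X + (Finset.univ.filter (fun v => X.1 v = none)).card = n := by
      have := Finset.card_filter_add_card_filter_not (s := Finset.univ)
        (fun v : Fin n => X.1 v = none)
      simp only [Finset.card_univ, Fintype.card_fin] at this
      rw [siz]; simp only [ne_eq]; omega
    have h2 : M < (Finset.univ.filter (fun v => X.1 v = none)).card := by
      by_contra! hle
      obtain ⟨j, A, hA, h⟩ := hcon X.1 hle
      rw [tot, Finset.sum_eq_zero_iff] at h0
      have := h0 (c A) (Finset.mem_range.2 (hc A hA))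
      rw [Finset.card_eq_zero] at this
      have hj : j ∈ fib F c X (c A) := by
        simp only [fib, Finset.mem_filter, Finset.mem_univ, true_and]
        exact ⟨A, hA, rfl, h⟩
      rw [this] at hj
      simp at hj
    omega
  have hpos : ∀ X : Vec p n, 0 < siz X := by
    intro X
    obtain ⟨i, a, hi⟩ := X.2
    exact Finset.card_pos.2 ⟨i, by simp [hi]⟩
  have hs : ∀ j (X : Vec p n), sgn F t c (vact j X) = sgn F t c X + j := by
    intro j X
    rw [sgn, sgn, tot_act, idx_act, fib_act]
    split_ifs with h
    · exact fst_act j X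
    · exact avg_shift _ (idx_spec F t c X h).2 (hfib _ _) j
  obtain ⟨w, hw1, hw2, hw3⟩ := chain_exists (by omega) (sgn F t c) hs
  let lev : Vec p n → ℕ := fun X => if tot F t c X = 0 then siz X else n - M - 1 + tot F t c X
  have hlev : ∀ X Y : Vec p n, X.le Y → sgn F t c X ≠ sgn F t c Y → lev X < lev Y := by
    intro X Y hXY hne
    have h1 := tot_mono F t c hXY
    have h2 := siz_mono hXY
    simp only [lev]
    by_cases hX : tot F t c X = 0
    · by_cases hY : tot F t c Y = 0
      · rw [if_pos hX, if_pos hY]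
        refine lt_of_le_of_ne h2 (fun h => hne ?_)
        rw [siz_eq hXY h]
      · rw [if_pos hX, if_neg hY]
        have := hsiz X hX
        omega
    · have hY : tot F t c Y ≠ 0 := by omega
      rw [if_neg hX, if_neg hY]
      have : tot F t c X ≠ tot F t c Y := fun h => hne (sgn_eq F t c hXY h hX)
      omega
  have hch : w.IsChain (fun X Y => lev X < lev Y) := by
    rw [List.isChain_map] at hw3
    exact chain_and hlev w hw2 hw3
  have hch2 : (w.map lev).IsChain (· < ·) := by rwa [List.isChain_map]
  have hnd : (w.map lev).Nodup := (List.isChain_iff_pairwise.1 hch2).imp (fun h => ne_of_lt h)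
  have hsub : (w.map lev).toFinset ⊆ Finset.Ico 1 n := by
    intro x hx
    rw [List.mem_toFinset, List.mem_map] at hx
    obtain ⟨X, -, rfl⟩ := hx
    rw [Finset.mem_Ico]
    simp only [lev]
    have h1 := hpos X
    have h2 := htot X
    have h3 := hsiz X
    split_ifs with h
    · have := h3 h; omega
    · omega
  have := Finset.card_le_card hsub
  rw [List.toFinset_card_of_nodup hnd, List.length_map, hw1, Nat.card_Ico] at this
  omega

end prime

lemma KP_equiv {n : ℕ} {ι κ : Type} [Fintype ι] [Fintype κ] (e : ι ≃ κ) (h : KP n ι) :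
    KP n κ := by
  intro F t c hF hc hno
  obtain ⟨X, hX1, hX2⟩ := h F t c hF hc (by
    rintro ⟨A, h1, h2, h3⟩
    exact hno ⟨A ∘ e.symm, fun i => h1 _, fun i j hij => h2 _ _ (by simpa using hij),
      fun i j => h3 _ _⟩)
  refine ⟨fun v => (X v).map e, ?_, ?_⟩
  · simpa [Fintype.card_congr e] using hX1
  · intro j A hA
    obtain ⟨a, ha, h⟩ := hX2 (e.symm j) A hA
    refine ⟨a, ha, fun h' => h ?_⟩
    obtain ⟨b, hb, rfl⟩ := Option.map_eq_some_iff.1 h'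
    simpa using hb

lemma KP_prod {n : ℕ} {ι κ : Type} [Fintype ι] [Fintype κ] [Nonempty ι] [Nonempty κ]
    (hι : KP n ι) (hκ : KP n κ) : KP n (ι × κ) := by
  classical
  intro F t c hF hc hno
  -- `N` is bad if `F` restricted to `N` has large `ι`-defect
  let ok : Finset (Fin n) → (Fin n → Option ι) → Prop := fun N X =>
    (Finset.univ.filter (fun v => X v = none)).card ≤ (Fintype.card ι - 1) * t ∧
      ∀ j, ∀ A ∈ F, A ⊆ N → ∃ a ∈ A, X a ≠ some j
  let G : Set (Finset (Fin n)) := {N | ¬ ∃ X, ok N X}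
  have hmono : ∀ N ∈ G, ∃ i < t, ∃ A : ι → Finset (Fin n), (∀ k, A k ∈ F ∧ A k ⊆ N ∧ c (A k) = i) ∧
      ∀ k l, k ≠ l → Disjoint (A k) (A l) := by
    intro N hN
    have := hι {A | A ∈ F ∧ A ⊆ N} t c (fun A hA => hF A hA.1) (fun A hA => hc A hA.1)
    by_contra hcon
    apply hN
    obtain ⟨X, h1, h2⟩ := this (by
      rintro ⟨A, h1, h2, h3⟩
      apply hcon
      obtain ⟨k⟩ := ‹Nonempty ι›
      exact ⟨c (A k), hc _ (h1 k).1, A, fun l => ⟨(h1 l).1, (h1 l).2, h3 _ _⟩, h2⟩)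
    exact ⟨X, h1, fun j A hA hAN => h2 j A ⟨hA, hAN⟩⟩
  choose! d hd A hA hdis using hmono
  have hGne : ∀ N ∈ G, N.Nonempty := by
    intro N hN
    obtain ⟨k⟩ := ‹Nonempty ι›
    exact (hF _ (hA N hN k).1).mono (hA N hN k).2.1
  obtain ⟨Y, hY1, hY2⟩ := hκ G t d hGne hd (by
    rintro ⟨N, h1, h2, h3⟩
    refine hno ⟨fun q => A (N q.2) q.1, fun q => (hA _ (h1 _) _).1, ?_, ?_⟩
    · rintro ⟨k, l⟩ ⟨k', l'⟩ hne
      by_cases hl : l = l'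
      · subst hl
        exact hdis _ (h1 _) _ _ (fun h => hne (Prod.ext h rfl))
      · exact (h2 l l' hl).mono (hA _ (h1 _) _).2.1 (hA _ (h1 _) _).2.1
    · intro q q'
      rw [(hA _ (h1 _) _).2.2, (hA _ (h1 _) _).2.2, h3])
  -- each colour class of `Y` is not in `G`
  have hcl : ∀ l : κ, ∃ X, ok (Finset.univ.filter (fun v => Y v = some l)) X := by
    intro l
    by_contra hcon
    obtain ⟨a, ha, h⟩ := hY2 l _ hcon
    exact h (by simpa using ha)
  choose Z hZ1 hZ2 using hcl
  refine ⟨fun v => (Y v).bind (fun l => (Z l v).map (fun k => (k, l))), ?_, ?_⟩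
  · have hsub : Finset.univ.filter (fun v =>
        (Y v).bind (fun l => (Z l v).map (fun k => (k, l))) = none) ⊆
        Finset.univ.filter (fun v => Y v = none) ∪
          Finset.univ.biUnion (fun l => Finset.univ.filter (fun v => Z l v = none)) := by
      intro v
      simp only [Finset.mem_filter, Finset.mem_univ, true_and, Finset.mem_union,
        Finset.mem_biUnion]
      rcases hv : Y v with _ | l
      · simp
      · intro h
        right
        exact ⟨l, by simpa using h⟩
    refine le_trans (Finset.card_le_card hsub) ?_
    refine le_trans (Finset.card_union_le _ _) ?_
    have h2 : (Finset.univ.biUnion (fun l => Finset.univ.filter (fun v => Z l v = none))).card ≤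
        Fintype.card κ * ((Fintype.card ι - 1) * t) := by
      refine Finset.card_biUnion_le.trans ((Finset.sum_le_sum (fun l _ => hZ1 l)).trans ?_)
      simp
    have hk : 0 < Fintype.card κ := Fintype.card_pos
    have hi : 0 < Fintype.card ι := Fintype.card_pos
    rw [Fintype.card_prod]
    obtain ⟨a, ha⟩ : ∃ a, Fintype.card κ = a + 1 := ⟨_, (Nat.sub_add_cancel hk).symm⟩
    obtain ⟨b, hb⟩ : ∃ b, Fintype.card ι = b + 1 := ⟨_, (Nat.sub_add_cancel hi).symm⟩
    rw [ha] at hY1 h2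
    rw [hb] at h2
    rw [ha, hb]
    have h3 : (b + 1) * (a + 1) - 1 = a + (a + 1) * b := by
      have : (b + 1) * (a + 1) = a + (a + 1) * b + 1 := by ring
      omega
    rw [h3, add_mul]
    simp only [Nat.add_sub_cancel] at hY1 h2
    have h4 : (a + 1) * (b * t) = (a + 1) * b * t := by ring
    omega
  · rintro ⟨k, l⟩ B hB
    by_contra! hcon
    have hY : ∀ a ∈ B, Y a = some l ∧ Z l a = some k := by
      intro a ha
      have := hcon a ha
      rw [Option.bind_eq_some_iff] at this
      obtain ⟨l', h1, h2⟩ := this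
      obtain ⟨k', h3, h4⟩ := Option.map_eq_some_iff.1 h2
      obtain ⟨rfl, rfl⟩ := Prod.mk.inj h4
      exact ⟨h1, h3⟩
    obtain ⟨a, ha, h⟩ := hZ2 l k B hB (fun a ha => by simpa using (hY a ha).1)
    exact h (hY a ha).2

lemma KP_all (n r : ℕ) (hr : 2 ≤ r) : KP n (Fin r) := by
  induction r using Nat.strong_induction_on with
  | _ r ih =>
    by_cases hp : r.Prime
    · have := Fact.mk hp
      exact KP_equiv (ZMod.finEquiv r).toEquiv.symm prime_case
    · obtain ⟨a, hab, ha2, har⟩ := Nat.exists_dvd_of_not_prime2 hr hp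
      obtain ⟨b, rfl⟩ := hab
      have hb : 2 ≤ b := by
        by_contra! h
        interval_cases b <;> omega
      have hblt : b < a * b := by nlinarith
      have : Nonempty (Fin a) := ⟨⟨0, by omega⟩⟩
      have : Nonempty (Fin b) := ⟨⟨0, by omega⟩⟩
      exact KP_equiv finProdFinEquiv (KP_prod (ih a har ha2) (ih b hblt hb))

end Kriz

/-- Dol'nikov–Kříž: `χ(KG^r(F)) ≥ cd_r(F) / (r - 1)`. -/
theorem stmt5 (n r : ℕ) (hr : 2 ≤ r) (F : Finset (Finset (Fin n)))
    (hF : ∀ A ∈ F, A.Nonempty) :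
    (cdr n r F : ℚ) / ((r : ℚ) - 1) ≤ (kneserChrom n r F : ℚ) := by
  classical
  -- the set of admissible numbers of colours is nonempty
  have hne : {t | ∃ c, IsKneserColoring n r t F c}.Nonempty := by
    refine ⟨F.card, fun A => if h : A ∈ F then (F.equivFin ⟨A, h⟩).1 + 1 else 0, ?_, ?_⟩
    · intro A hA
      beta_reduce
      rw [dif_pos hA, Finset.mem_Icc]
      have := (F.equivFin ⟨A, hA⟩).2
      omega
    · rintro E hE hcard - ⟨i, hi⟩
      obtain ⟨A, hA, B, hB, hAB⟩ := Finset.one_lt_card.1 (show 1 < E.card by omega)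
      have h1 := hi A hA
      have h2 := hi B hB
      beta_reduce at h1 h2
      rw [dif_pos (hE hA)] at h1
      rw [dif_pos (hE hB)] at h2
      have h3 : F.equivFin ⟨A, hE hA⟩ = F.equivFin ⟨B, hE hB⟩ := by
        apply Fin.ext; omega
      exact hAB (congrArg Subtype.val (F.equivFin.injective h3))
  obtain ⟨c, hc1, hc2⟩ : ∃ c, IsKneserColoring n r (kneserChrom n r F) F c := Nat.sInf_mem hne
  set t := kneserChrom n r F with ht
  obtain ⟨X, hX1, hX2⟩ := Kriz.KP_all n r hr {A | A ∈ F} t (fun A => c A - 1)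
    (fun A hA => hF A hA)
    (fun A hA => by have := Finset.mem_Icc.1 (hc1 A hA); show c A - 1 < t; omega) (by
      rintro ⟨A, h1, h2, h3⟩
      have hinj : Function.Injective A := by
        intro i j hij
        by_contra hne
        have h4 := h2 i j hne
        rw [hij, disjoint_self, Finset.bot_eq_empty] at h4
        exact (hF _ (h1 j)).ne_empty h4
      refine hc2 (Finset.univ.image A) ?_ ?_ ?_ ⟨c (A ⟨0, by omega⟩), ?_⟩
      · intro B hB
        obtain ⟨i, -, rfl⟩ := Finset.mem_image.1 hB
        exact h1 i
      · rw [Finset.card_image_of_injective _ hinj]; simp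
      · intro B hB C hC hBC
        obtain ⟨i, -, rfl⟩ := Finset.mem_image.1 (Finset.mem_coe.1 hB)
        obtain ⟨j, -, rfl⟩ := Finset.mem_image.1 (Finset.mem_coe.1 hC)
        exact h2 i j (fun h => hBC (by rw [h]))
      · intro B hB
        obtain ⟨i, -, rfl⟩ := Finset.mem_image.1 hB
        have h5 : c (A i) - 1 = c (A ⟨0, by omega⟩) - 1 := h3 i ⟨0, by omega⟩
        have h6 := Finset.mem_Icc.1 (hc1 _ (h1 i))
        have h7 := Finset.mem_Icc.1 (hc1 _ (h1 ⟨0, by omega⟩))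
        omega)
  rw [Fintype.card_fin] at hX1
  let T : Finset (Fin n) := Finset.univ.filter (fun v => X v ≠ none)
  have hT : T.card ≤ Mr n r F := by
    refine le_csSup ⟨n, ?_⟩ ⟨T, rfl, fun v => (X v).getD ⟨0, by omega⟩, ?_⟩
    · rintro k ⟨S, rfl, -⟩
      simpa using Finset.card_le_univ S
    · intro A hA
      rw [Finset.mem_filter] at hA
      rintro ⟨j, hj⟩
      obtain ⟨a, ha, h⟩ := hX2 j A hA.1
      have h1 := hj a ha
      have h2 : X a ≠ none := by simpa [T] using hA.2 ha
      obtain ⟨b, hb⟩ := Option.ne_none_iff_exists'.1 h2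
      beta_reduce at h1
      rw [hb] at h h1
      exact h (by simpa using h1)
  have hTn : (Finset.univ.filter (fun v => X v = none)).card + T.card = n := by
    have := Finset.card_filter_add_card_filter_not (s := Finset.univ)
      (fun v : Fin n => X v = none)
    simpa [T] using this
  have hmain : cdr n r F ≤ (r - 1) * t := by
    rw [cdr]; omega
  have hr1 : (0 : ℚ) < (r : ℚ) - 1 := by
    have : (2 : ℚ) ≤ r := by exact_mod_cast hr
    linarith
  rw [div_le_iff₀ hr1]
  have h2 : ((cdr n r F : ℕ) : ℚ) ≤ (((r - 1) * t : ℕ) : ℚ) := by exact_mod_cast hmain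
  rw [Nat.cast_mul, Nat.cast_sub (by omega)] at h2
  push_cast at h2
  linarith
end
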